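/- arXiv:2009.02953 — 2 statements merged into one kernel-verified Lean document; each statement's English description precedes it below -/
import Mathlib

section
/- A hereditary class 𝒞 of graphs has ω-bounded expansion if and only if the following three conditions all hold: (i) 𝒞 is χ-bounded; (ii) there exists an integer s such that K_{s,s} ∉ 𝒞; (iii) for every integer r ≥ 1, d̄(ITM_r^e(𝒞)) < ∞. -/
open SimpleGraph

/-! ## Basic containment relations between graphs -/

/-- `H` is isomorphic to a (not necessarily induced) subgraph of `G`. -/
def IsSubgraphOf {V W : Type*} (H : SimpleGraph V) (G : SimpleGraph W) : Prop :=
  ∃ f : H →g G, Function.Injective f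

/-- `H` is isomorphic to an induced subgraph of `G`. -/
def IsInducedSubgraphOf {V W : Type*} (H : SimpleGraph V) (G : SimpleGraph W) : Prop :=
  Nonempty (H ↪g G)

/-- The clique number `ω(G)`: the largest `m` such that `K_m` is a subgraph of `G`. -/
noncomputable def omegaNum {V : Type*} (G : SimpleGraph V) : ℕ :=
  sSup {m | IsSubgraphOf (⊤ : SimpleGraph (Fin m)) G}

/-- The chromatic number `χ(G)` (as a natural number). -/
noncomputable def chi {V : Type*} (G : SimpleGraph V) : ℕ :=
  sInf {N | G.Colorable N}

/-! ## Tree-depth and the invariants `χ_p` -/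

/-- A forest order: a partial order in which the down-set of every element is a chain.
Such orders are exactly the ancestor orders of rooted forests. -/
def IsForestOrder {V : Type*} (r : V → V → Prop) : Prop :=
  (∀ v, r v v) ∧ (∀ u v, r u v → r v u → u = v) ∧
  (∀ u v w, r u v → r v w → r u w) ∧
  (∀ u v w, r u w → r v w → r u v ∨ r v u)

/-- `G` has tree-depth at most `h`: `G` is a subgraph of the closure of a rooted forest
of height at most `h` (height = maximum number of vertices on a root-to-leaf path). -/
def TreeDepthLE {V : Type*} (G : SimpleGraph V) (h : ℕ) : Prop :=
  ∃ r : V → V → Prop, IsForestOrder r ∧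
    (∀ u v, G.Adj u v → r u v ∨ r v u) ∧
    (∀ v, {u | r u v}.ncard ≤ h)

/-- The tree-depth `td(G)`. -/
noncomputable def treeDepth {V : Type*} (G : SimpleGraph V) : ℕ :=
  sInf {h | TreeDepthLE G h}

/-- `χ_p(G)`: the least number of colors of a vertex coloring such that every set `I` of at
most `p` colors induces a subgraph of tree-depth at most `|I|`. -/
noncomputable def chiP {V : Type*} (G : SimpleGraph V) (p : ℕ) : ℕ :=
  sInf {N | ∃ c : V → Fin N, ∀ I : Finset (Fin N), I.card ≤ p →
    TreeDepthLE (G.induce {v | c v ∈ I}) I.card}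

/-! ## Star colorings -/

/-- A star coloring: a proper coloring with no path on `4` vertices using only two colors. -/
def IsStarColoring {V α : Type*} (G : SimpleGraph V) (c : V → α) : Prop :=
  (∀ u v, G.Adj u v → c u ≠ c v) ∧
  ∀ x y z w : V, G.Adj x y → G.Adj y z → G.Adj z w →
    x ≠ z → y ≠ w → x ≠ w → ¬(c x = c z ∧ c y = c w)

/-- The star chromatic number `χ_s(G)`. -/
noncomputable def starChi {V : Type*} (G : SimpleGraph V) : ℕ :=
  sInf {N | ∃ c : V → Fin N, IsStarColoring G c}

/-! ## Subdivisions -/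

/-- The edges of a graph on `Fin n`, presented as increasingly ordered pairs. -/
def Edges {n : ℕ} (H : SimpleGraph (Fin n)) : Type :=
  {p : Fin n × Fin n // p.1 < p.2 ∧ H.Adj p.1 p.2}

/-- Base relation of the subdivision of `H`, where the edge `e` receives `t e` internal
vertices. -/
def subdivRel {n : ℕ} (H : SimpleGraph (Fin n)) (t : Edges H → ℕ) :
    (Fin n ⊕ Σ e : Edges H, Fin (t e)) → (Fin n ⊕ Σ e : Edges H, Fin (t e)) → Prop
  | Sum.inl u, Sum.inl v => ∃ h : u < v ∧ H.Adj u v, t ⟨(u, v), h⟩ = 0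
  | Sum.inl u, Sum.inr ⟨e, i⟩ =>
      (u = e.1.1 ∧ (i : ℕ) = 0) ∨ (u = e.1.2 ∧ (i : ℕ) + 1 = t e)
  | Sum.inr ⟨e, i⟩, Sum.inr ⟨e', j⟩ => e = e' ∧ (i : ℕ) + 1 = (j : ℕ)
  | _, _ => False

/-- The subdivision of `H` in which each edge `e` is replaced by a path with exactly `t e`
internal vertices. In particular `Subdiv H (fun _ => r)` is the `r`-subdivision `H^{(r)}`,
and the `(≤ r)`-subdivisions of `H` are the graphs `Subdiv H t` with `t e ≤ r` for all `e`. -/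
def Subdiv {n : ℕ} (H : SimpleGraph (Fin n)) (t : Edges H → ℕ) :
    SimpleGraph (Fin n ⊕ Σ e : Edges H, Fin (t e)) :=
  SimpleGraph.fromRel (subdivRel H t)

/-- `H ∈ TM_r(G)`: some `(≤ r)`-subdivision of `H` is a subgraph of `G`. -/
def MemTM {W : Type*} (r : ℕ) (G : SimpleGraph W) {n : ℕ} (H : SimpleGraph (Fin n)) : Prop :=
  ∃ t : Edges H → ℕ, (∀ e, t e ≤ r) ∧ IsSubgraphOf (Subdiv H t) G

/-- `H ∈ ITM_r^e(G)`: the exact `r`-subdivision of `H` is an induced subgraph of `G`. -/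
def MemITM {W : Type*} (r : ℕ) (G : SimpleGraph W) {n : ℕ} (H : SimpleGraph (Fin n)) : Prop :=
  IsInducedSubgraphOf (Subdiv H (fun _ => r)) G

/-- `ω(TM_r(G))`: the supremum of the clique numbers of the graphs in `TM_r(G)`. -/
noncomputable def omegaTM {W : Type*} (r : ℕ) (G : SimpleGraph W) : ℕ :=
  sSup {m | ∃ (k : ℕ) (H : SimpleGraph (Fin k)), MemTM r G H ∧ omegaNum H = m}

/-- The biclique number `bω(G)`: the largest `s` with `K_{s,s}` a subgraph of `G`. -/
noncomputable def bomega {V : Type*} (G : SimpleGraph V) : ℕ :=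
  sSup {s | IsSubgraphOf (completeBipartiteGraph (Fin s) (Fin s)) G}

/-- The average degree `d̄(G) = 2|E(G)|/|V(G)|`. -/
noncomputable def avgDeg {n : ℕ} (G : SimpleGraph (Fin n)) : ℝ :=
  2 * (G.edgeSet.ncard : ℝ) / n

/-! ## Classes of graphs -/

/-- A class of (finite, simple) graphs: for each `n`, a set of graphs on `Fin n`.
Classes are implicitly closed under isomorphism via the relations used below. -/
def GraphClass := ∀ n : ℕ, Set (SimpleGraph (Fin n))

/-- A hereditary class: closed under induced subgraphs (hence under isomorphism). -/
def Hereditary (C : GraphClass) : Prop :=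
  ∀ ⦃n m : ℕ⦄ (G : SimpleGraph (Fin n)) (H : SimpleGraph (Fin m)),
    G ∈ C n → IsInducedSubgraphOf H G → H ∈ C m

/-- A monotone class: closed under subgraphs (hence under isomorphism). -/
def MonotoneClass (C : GraphClass) : Prop :=
  ∀ ⦃n m : ℕ⦄ (G : SimpleGraph (Fin n)) (H : SimpleGraph (Fin m)),
    G ∈ C n → IsSubgraphOf H G → H ∈ C m

/-- `H ∈ TM_r(𝒞)`. -/
def MemTMClass (r : ℕ) (C : GraphClass) {m : ℕ} (H : SimpleGraph (Fin m)) : Prop :=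
  ∃ (n : ℕ) (G : SimpleGraph (Fin n)), G ∈ C n ∧ MemTM r G H

/-- `H ∈ ITM_r^e(𝒞)`. -/
def MemITMClass (r : ℕ) (C : GraphClass) {m : ℕ} (H : SimpleGraph (Fin m)) : Prop :=
  ∃ (n : ℕ) (G : SimpleGraph (Fin n)), G ∈ C n ∧ MemITM r G H

/-- `𝒞` is `χ`-bounded: `χ(H) ≤ f(ω(H))` for every induced subgraph `H` of a graph of `𝒞`. -/
def ChiBounded (C : GraphClass) : Prop :=
  ∃ f : ℕ → ℕ, ∀ ⦃n : ℕ⦄ (G : SimpleGraph (Fin n)), G ∈ C n →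
    ∀ ⦃m : ℕ⦄ (H : SimpleGraph (Fin m)), IsInducedSubgraphOf H G →
      chi H ≤ f (omegaNum H)

/-- `𝒞` has bounded expansion: for every `r`, `d̄(TM_r(𝒞)) < ∞`. -/
def BoundedExpansion (C : GraphClass) : Prop :=
  ∀ r : ℕ, ∃ d : ℝ, ∀ ⦃m : ℕ⦄ (H : SimpleGraph (Fin m)), MemTMClass r C H → avgDeg H ≤ d

/-- `𝒞` has `ω`-bounded expansion. -/
def OmegaBoundedExpansion (C : GraphClass) : Prop :=
  ∃ f : ℕ → ℕ → ℝ, ∀ ⦃n : ℕ⦄ (G : SimpleGraph (Fin n)), G ∈ C n →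
    ∀ (r : ℕ) ⦃m : ℕ⦄ (H : SimpleGraph (Fin m)), MemTM r G H →
      avgDeg H ≤ f (omegaNum G) r

/-- `𝒞` is nowhere dense: for every `r`, `ω(TM_r(𝒞)) < ∞`. -/
def NowhereDense (C : GraphClass) : Prop :=
  ∀ r : ℕ, ∃ c : ℕ, ∀ ⦃m : ℕ⦄ (H : SimpleGraph (Fin m)), MemTMClass r C H → omegaNum H ≤ c

/-- `𝒞` is strongly `χ_p`-bounded: `χ_p(G) ≤ f_p(ω(G))` on `𝒞`. -/
def StronglyChiPBounded (C : GraphClass) (p : ℕ) : Prop :=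
  ∃ f : ℕ → ℕ, ∀ ⦃n : ℕ⦄ (G : SimpleGraph (Fin n)), G ∈ C n → chiP G p ≤ f (omegaNum G)

/-- `𝒞` is weakly `χ_p`-bounded: `χ_p(G) ≤ g_p(ω(TM_{p-1}(G)))` on `𝒞`. -/
def WeaklyChiPBounded (C : GraphClass) (p : ℕ) : Prop :=
  ∃ g : ℕ → ℕ, ∀ ⦃n : ℕ⦄ (G : SimpleGraph (Fin n)), G ∈ C n → chiP G p ≤ g (omegaTM (p - 1) G)

/-! ## Directed graphs, orientations and restricted dualities -/

/-- Existence of a homomorphism between directed graphs presented as binary relations. -/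
def DigraphHomEx {n m : ℕ} (A : Fin n → Fin n → Prop) (B : Fin m → Fin m → Prop) : Prop :=
  ∃ f : Fin n → Fin m, ∀ u v, A u v → B (f u) (f v)

/-- `A` is an orientation of the graph `G`. -/
def IsOrientationOf {n : ℕ} (A : Fin n → Fin n → Prop) (G : SimpleGraph (Fin n)) : Prop :=
  (∀ u v, ¬(A u v ∧ A v u)) ∧ (∀ u v, G.Adj u v ↔ (A u v ∨ A v u))

/-- A directed graph is acyclic if it has no directed cycle. -/
def IsAcyclicDigraph {n : ℕ} (A : Fin n → Fin n → Prop) : Prop :=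
  ∀ v, ¬ Relation.TransGen A v v

/-- The directed graph `F` has a restricted dual for the class of all orientations of the
graphs of `𝒞`. -/
def HasRestrictedDualForOrientations (C : GraphClass) {nF : ℕ}
    (F : Fin nF → Fin nF → Prop) : Prop :=
  ∃ (m : ℕ) (D : Fin m → Fin m → Prop),
    ¬ DigraphHomEx F D ∧
    ∀ ⦃n : ℕ⦄ (A : Fin n → Fin n → Prop) (G : SimpleGraph (Fin n)),
      G ∈ C n → IsOrientationOf A G →
      (¬ DigraphHomEx F A ↔ DigraphHomEx A D)

/-! ## Holes -/

/-- The number `h_g(G)` of holes of length `g` in `G`, i.e. of vertex subsets inducing a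
cycle on `g` vertices. -/
noncomputable def holeCount {n : ℕ} (g : ℕ) (G : SimpleGraph (Fin n)) : ℕ :=
  {S : Set (Fin n) | Nonempty (G.induce S ≃g SimpleGraph.cycleGraph g)}.ncard

/-- `G` is even hole-free: it has no induced cycle of even length at least `4`. -/
def EvenHoleFree {n : ℕ} (G : SimpleGraph (Fin n)) : Prop :=
  ∀ g : ℕ, 4 ≤ g → Even g → holeCount g G = 0


/-! ## Counting lemmas on finite sets -/

/-- A random subset `X` contains `P e` and avoids `Q e` for a positive fraction of the `e ∈ F`,
provided that the sets `P e` and `Q e` are disjoint and have bounded size. -/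
lemma exists_subset_separating {ι V : Type*} [Fintype V] [DecidableEq V] (F : Finset ι)
    (P Q : ι → Finset V) (m : ℕ) (hd : ∀ e ∈ F, Disjoint (P e) (Q e))
    (hm : ∀ e ∈ F, (P e).card + (Q e).card ≤ m) :
    ∃ X : Finset V, F.card ≤ 2 ^ m * (F.filter fun e => P e ⊆ X ∧ Disjoint (Q e) X).card := by
  by_contra! hcon
  have h1 : ∀ e ∈ F, 2 ^ (Fintype.card V) ≤
      2 ^ m * (Finset.univ.filter fun X : Finset V => P e ⊆ X ∧ Disjoint (Q e) X).card := by
    intro e he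
    have hsub : P e ⊆ (Q e)ᶜ := by
      intro x hx
      simpa using Finset.disjoint_left.1 (hd e he) hx
    have heq : (Finset.univ.filter fun X : Finset V => P e ⊆ X ∧ Disjoint (Q e) X)
        = Finset.Icc (P e) (Q e)ᶜ := by
      ext X
      simp only [Finset.mem_filter, Finset.mem_univ, true_and, Finset.mem_Icc,
        Finset.subset_compl_iff_disjoint_left]
    rw [heq, Finset.card_Icc_finset hsub, Finset.card_compl, ← pow_add]
    apply Nat.pow_le_pow_right (by norm_num)
    have := hm e he
    omega
  have h2 : ∑ X : Finset V, 2 ^ m * (F.filter fun e => P e ⊆ X ∧ Disjoint (Q e) X).card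
      < ∑ _X : Finset V, F.card := by
    apply Finset.sum_lt_sum_of_nonempty ⟨∅, Finset.mem_univ _⟩
    intro X _
    exact hcon X
  have h3 : ∑ X : Finset V, (F.filter fun e => P e ⊆ X ∧ Disjoint (Q e) X).card
      = ∑ e ∈ F, (Finset.univ.filter fun X : Finset V => P e ⊆ X ∧ Disjoint (Q e) X).card := by
    simp only [Finset.card_filter]
    rw [Finset.sum_comm]
  rw [← Finset.mul_sum, h3, Finset.mul_sum] at h2
  have h4 := Finset.sum_le_sum h1
  simp at h2 h4
  rw [mul_comm] at h4
  omega

/-- If the expected change of `∑ a, g |N a ∩ S|` under the removal of a random element of `S` is at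
most `c`, for every `S ⊆ B`, then this sum is at most `c * |S|` for every `S ⊆ B`. -/
lemma sum_le_of_random_removal {α V : Type*} [DecidableEq V] (A : Finset α) (N : α → Finset V)
    (B : Finset V) (g : ℕ → ℝ) (hg : g 0 = 0) (c : ℝ)
    (h : ∀ S ⊆ B, ∑ a ∈ A, ((N a ∩ S).card : ℝ) * (g (N a ∩ S).card - g ((N a ∩ S).card - 1))
      ≤ c * S.card) :
    ∀ S ⊆ B, ∑ a ∈ A, g (N a ∩ S).card ≤ c * S.card := by
  intro S
  induction S using Finset.strongInduction with
  | H S ih =>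
  intro hS
  rcases S.eq_empty_or_nonempty with rfl | hne
  · simp [hg]
  have key : ∑ v ∈ S, ∑ a ∈ A, (g (N a ∩ S).card - g (N a ∩ S.erase v).card) ≤ ∑ _v ∈ S, c := by
    rw [Finset.sum_comm]
    have : ∀ a ∈ A, ∑ v ∈ S, (g (N a ∩ S).card - g (N a ∩ S.erase v).card)
        = ((N a ∩ S).card : ℝ) * (g (N a ∩ S).card - g ((N a ∩ S).card - 1)) := by
      intro a _
      have : ∀ v ∈ S, (g (N a ∩ S).card - g (N a ∩ S.erase v).card)
          = if v ∈ N a then (g (N a ∩ S).card - g ((N a ∩ S).card - 1)) else 0 := by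
        intro v hv
        rw [Finset.inter_erase]
        split_ifs with hvN
        · rw [Finset.card_erase_of_mem (by simp [hv, hvN])]
        · rw [Finset.erase_eq_of_notMem (by simp [hvN]), sub_self]
      rw [Finset.sum_congr rfl this, ← Finset.sum_filter, Finset.sum_const, nsmul_eq_mul,
        Finset.filter_mem_eq_inter, Finset.inter_comm S]
    rw [Finset.sum_congr rfl this]
    simpa [mul_comm] using h S hS
  obtain ⟨v, hv, hle⟩ := Finset.exists_le_of_sum_le hne key
  have := ih (S.erase v) (Finset.erase_ssubset hv) ((Finset.erase_subset _ _).trans hS)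
  rw [Finset.card_erase_of_mem hv, Nat.cast_sub (Finset.card_pos.2 hne)] at this
  rw [Finset.sum_sub_distrib] at hle
  push_cast at this
  linarith

/-! ## Degenerate graphs -/

/-- Every nonempty set `U ⊆ S` has an element with at most `q` neighbours in `U`. -/
def DegenerateOn {V : Type*} (G : SimpleGraph V) (S : Finset V) (q : ℕ) : Prop :=
  ∀ U ⊆ S, U.Nonempty → ∃ v ∈ U, {w | w ∈ U ∧ G.Adj v w}.ncard ≤ q

lemma DegenerateOn.mono {V : Type*} {G : SimpleGraph V} {S T : Finset V} {q : ℕ}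
    (h : DegenerateOn G S q) (hT : T ⊆ S) : DegenerateOn G T q :=
  fun U hU => h U (hU.trans hT)

open Classical in
lemma DegenerateOn.exists_orientation {V : Type*} {G : SimpleGraph V} {q : ℕ}
    {S : Finset V} (h : DegenerateOn G S q) :
    ∃ out : V → Finset V, (∀ v, (out v).card ≤ q) ∧
      ∀ u ∈ S, ∀ v ∈ S, G.Adj u v → v ∈ out u ∨ u ∈ out v := by
  induction S using Finset.strongInduction with
  | H S ih =>
  rcases S.eq_empty_or_nonempty with rfl | hne
  · exact ⟨fun _ => ∅, by simp, by simp⟩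
  obtain ⟨v, hv, hq⟩ := h S subset_rfl hne
  obtain ⟨out, ho1, ho2⟩ := ih (S.erase v) (Finset.erase_ssubset hv)
    (h.mono (Finset.erase_subset _ _))
  refine ⟨Function.update out v (S.filter (G.Adj v)), ?_, ?_⟩
  · intro u
    by_cases huv : u = v
    · subst huv
      rw [Function.update_self, ← Set.ncard_coe_finset]
      simpa using hq
    · rw [Function.update_of_ne huv]
      exact ho1 u
  · intro x hx y hy hxy
    by_cases hxv : x = v
    · subst hxv
      left
      simp [hy, hxy]
    by_cases hyv : y = v
    · subst hyv
      right
      simp [hx, hxy.symm]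
    rw [Function.update_of_ne hxv, Function.update_of_ne hyv]
    exact ho2 x (by simp [hx, hxv]) y (by simp [hy, hyv]) hxy

open Classical in
lemma DegenerateOn.exists_coloring {V : Type*} {G : SimpleGraph V} {q : ℕ}
    {S : Finset V} (h : DegenerateOn G S q) :
    ∃ c : V → Fin (q + 1), ∀ u ∈ S, ∀ v ∈ S, G.Adj u v → c u ≠ c v := by
  induction S using Finset.strongInduction with
  | H S ih =>
  rcases S.eq_empty_or_nonempty with rfl | hne
  · exact ⟨fun _ => 0, by simp⟩
  obtain ⟨v, hv, hq⟩ := h S subset_rfl hne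
  obtain ⟨c, hc⟩ := ih (S.erase v) (Finset.erase_ssubset hv) (h.mono (Finset.erase_subset _ _))
  have hcard : (S.filter (G.Adj v)).card ≤ q := by
    rw [← Set.ncard_coe_finset]
    simpa using hq
  obtain ⟨k, hk⟩ : ∃ k, k ∉ (S.filter (G.Adj v)).image c := by
    by_contra! hall
    have h1 : (Finset.univ : Finset (Fin (q + 1))) ⊆ (S.filter (G.Adj v)).image c :=
      fun k _ => hall k
    have h2 := (Finset.card_le_card h1).trans Finset.card_image_le
    rw [Finset.card_univ, Fintype.card_fin] at h2
    omega
  have hk' : ∀ w ∈ S, G.Adj v w → c w ≠ k := by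
    intro w hw hvw hcw
    exact hk (Finset.mem_image.2 ⟨w, by simp [hw, hvw], hcw⟩)
  refine ⟨Function.update c v k, ?_⟩
  intro x hx y hy hxy
  by_cases hxv : x = v
  · subst hxv
    rw [Function.update_self, Function.update_of_ne hxy.ne']
    exact (hk' y hy hxy).symm
  by_cases hyv : y = v
  · subst hyv
    rw [Function.update_self, Function.update_of_ne hxv]
    exact hk' x hx hxy.symm
  rw [Function.update_of_ne hxv, Function.update_of_ne hyv]
  exact hc x (by simp [hx, hxv]) y (by simp [hy, hyv]) hxy

open Classical in
/-- A `q`-degenerate graph has a linear number of cliques. -/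
lemma DegenerateOn.card_cliques_le {V : Type*} {G : SimpleGraph V} {q : ℕ}
    {S : Finset V} (h : DegenerateOn G S q) (𝓕 : Finset (Finset V))
    (h𝓕 : ∀ T ∈ 𝓕, T ⊆ S ∧ T.Nonempty ∧ ∀ x ∈ T, ∀ y ∈ T, x ≠ y → G.Adj x y) :
    𝓕.card ≤ 2 ^ q * S.card := by
  induction S using Finset.strongInduction generalizing 𝓕 with
  | H S ih =>
  rcases S.eq_empty_or_nonempty with rfl | hne
  · have : 𝓕 = ∅ := by
      apply Finset.eq_empty_of_forall_notMem
      intro T hT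
      obtain ⟨h1, h2, -⟩ := h𝓕 T hT
      exact h2.ne_empty (Finset.subset_empty.1 h1)
    simp [this]
  obtain ⟨v, hv, hq⟩ := h S subset_rfl hne
  have hcard : (S.filter (G.Adj v)).card ≤ q := by
    rw [← Set.ncard_coe_finset]
    simpa using hq
  have h1 := ih (S.erase v) (Finset.erase_ssubset hv) (h.mono (Finset.erase_subset _ _))
    (𝓕.filter fun T => v ∉ T) (by
      intro T hT
      rw [Finset.mem_filter] at hT
      obtain ⟨ha, hb, hc⟩ := h𝓕 T hT.1
      refine ⟨fun x hx => ?_, hb, hc⟩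
      rw [Finset.mem_erase]
      exact ⟨fun hxv => hT.2 (hxv ▸ hx), ha hx⟩)
  have h2 : (𝓕.filter fun T => v ∈ T).card ≤ 2 ^ q := by
    calc (𝓕.filter fun T => v ∈ T).card ≤ (S.filter (G.Adj v)).powerset.card := by
          apply Finset.card_le_card_of_injOn (fun T => T.erase v)
          · intro T hT
            rw [Finset.mem_coe, Finset.mem_filter] at hT
            obtain ⟨ha, hb, hc⟩ := h𝓕 T hT.1
            rw [Finset.mem_coe, Finset.mem_powerset]
            intro x hx
            rw [Finset.mem_erase] at hx
            rw [Finset.mem_filter]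
            exact ⟨ha hx.2, hc v hT.2 x hx.2 hx.1.symm⟩
          · intro T hT T' hT' heq
            rw [Finset.mem_coe, Finset.mem_filter] at hT hT'
            have := congrArg (insert v) heq
            simpa [Finset.insert_erase hT.2, Finset.insert_erase hT'.2] using this
      _ = 2 ^ (S.filter (G.Adj v)).card := Finset.card_powerset _
      _ ≤ 2 ^ q := Nat.pow_le_pow_right (by norm_num) hcard
  have h3 := Finset.card_filter_add_card_filter_not (s := 𝓕) (fun T => v ∈ T)
  rw [Finset.card_erase_of_mem hv] at h1
  have h4 : S.card = (S.card - 1) + 1 := by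
    have := Finset.card_pos.2 hne
    omega
  rw [h4, mul_add]
  omega

open Classical in
/-- A graph whose induced subgraphs have at most `d` edges per two vertices is degenerate. -/
lemma degenerateOn_of_card_pairs_le {V : Type*} [LinearOrder V] {G : SimpleGraph V}
    {S : Finset V} {q : ℕ}
    (h : ∀ U ⊆ S, 2 * ((U ×ˢ U).filter fun e => e.1 < e.2 ∧ G.Adj e.1 e.2).card ≤ q * U.card) :
    DegenerateOn G S q := by
  intro U hU hne
  have h1 : ∑ v ∈ U, (U.filter (G.Adj v)).card =
      2 * ((U ×ˢ U).filter fun e => e.1 < e.2 ∧ G.Adj e.1 e.2).card := by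
    have h2 : ∑ v ∈ U, (U.filter (G.Adj v)).card
        = ((U ×ˢ U).filter fun e => G.Adj e.1 e.2).card := by
      simp only [Finset.card_filter, Finset.sum_product]
    have h3 : ((U ×ˢ U).filter fun e => e.1 < e.2 ∧ G.Adj e.1 e.2).card
        = ((U ×ˢ U).filter fun e => ¬ e.1 < e.2 ∧ G.Adj e.1 e.2).card := by
      apply Finset.card_bij (fun e _ => (e.2, e.1))
      · intro e he
        simp only [Finset.mem_filter, Finset.mem_product, not_lt] at he ⊢
        exact ⟨⟨he.1.2, he.1.1⟩, he.2.1.le, he.2.2.symm⟩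
      · intro e _ e' _ hee
        simp only [Prod.mk.injEq] at hee
        exact Prod.ext hee.2 hee.1
      · intro e he
        simp only [Finset.mem_filter, Finset.mem_product, not_lt] at he
        refine ⟨(e.2, e.1), ?_, rfl⟩
        simp only [Finset.mem_filter, Finset.mem_product]
        exact ⟨⟨he.1.2, he.1.1⟩, lt_of_le_of_ne he.2.1 he.2.2.ne', he.2.2.symm⟩
    rw [h2, two_mul]
    nth_rewrite 2 [h3]
    have := Finset.card_filter_add_card_filter_not
      (s := (U ×ˢ U).filter fun e => G.Adj e.1 e.2) (fun e => e.1 < e.2)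
    rw [Finset.filter_filter, Finset.filter_filter] at this
    rw [← this]
    congr 2 <;> ext e <;> simp only [Finset.mem_filter] <;> tauto
  have h4 : ∑ v ∈ U, (U.filter (G.Adj v)).card ≤ ∑ _v ∈ U, q := by
    rw [h1, Finset.sum_const, smul_eq_mul, mul_comm U.card]
    exact h U hU
  obtain ⟨v, hv, hle⟩ := Finset.exists_le_of_sum_le hne h4
  refine ⟨v, hv, ?_⟩
  rw [← Set.ncard_coe_finset] at hle
  simpa using hle

/-! ## Subdivisions and their paths -/

lemma edgeSet_ncard_eq_card_pairs {n : ℕ} (H : SimpleGraph (Fin n)) :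
    H.edgeSet.ncard = {e : Fin n × Fin n | e.1 < e.2 ∧ H.Adj e.1 e.2}.ncard := by
  symm
  apply Set.ncard_congr (fun e _ => s(e.1, e.2))
  · intro e he
    exact he.2
  · intro e e' he he' h
    rcases Sym2.eq_iff.1 h with h | h
    · exact Prod.ext h.1 h.2
    · have h1 := he.1
      have h2 := he'.1
      rw [h.1, h.2] at h1
      exact absurd h1 h2.asymm
  · intro e
    induction e using Sym2.ind with
    | _ x y =>
    intro hxy
    rw [SimpleGraph.mem_edgeSet] at hxy
    rcases lt_or_gt_of_ne hxy.ne with h | h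
    · exact ⟨(x, y), ⟨h, hxy⟩, rfl⟩
    · exact ⟨(y, x), ⟨h, hxy.symm⟩, Sym2.eq_swap⟩

/-- The `k`-th vertex of the path replacing the edge `e`, starting at its smaller end. -/
def subdivVertex {n : ℕ} {H : SimpleGraph (Fin n)} (t : Edges H → ℕ) (e : Edges H) (k : ℕ) :
    Fin n ⊕ Σ e : Edges H, Fin (t e) :=
  if k = 0 then Sum.inl e.1.1 else
    if h : k - 1 < t e then Sum.inr ⟨e, ⟨k - 1, h⟩⟩ else Sum.inl e.1.2

section subdivVertex

variable {n : ℕ} {H : SimpleGraph (Fin n)} (t : Edges H → ℕ) (e : Edges H)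

lemma subdivVertex_zero : subdivVertex t e 0 = Sum.inl e.1.1 := rfl

lemma subdivVertex_last : subdivVertex t e (t e + 1) = Sum.inl e.1.2 := by
  simp [subdivVertex]

lemma subdivVertex_succ {k : ℕ} (h : k < t e) :
    subdivVertex t e (k + 1) = Sum.inr ⟨e, ⟨k, h⟩⟩ := by
  simp [subdivVertex, h]

lemma subdivVertex_adj {k : ℕ} (hk : k ≤ t e) :
    (Subdiv H t).Adj (subdivVertex t e k) (subdivVertex t e (k + 1)) := by
  rw [Subdiv, SimpleGraph.fromRel_adj]
  rcases k with _ | k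
  · rw [subdivVertex_zero]
    rcases Nat.eq_zero_or_pos (t e) with h0 | h0
    · have := subdivVertex_last t e
      rw [h0] at this
      rw [this]
      refine ⟨?_, Or.inl ⟨e.2, h0⟩⟩
      simpa using e.2.1.ne
    · rw [subdivVertex_succ t e h0]
      exact ⟨by simp, Or.inl (Or.inl ⟨rfl, rfl⟩)⟩
  · rw [subdivVertex_succ t e (Nat.lt_of_succ_le hk)]
    rcases Nat.lt_or_ge (k + 1) (t e) with h1 | h1
    · rw [subdivVertex_succ t e h1]
      exact ⟨by simp, Or.inl ⟨rfl, rfl⟩⟩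
    · have h2 : k + 1 = t e := le_antisymm hk h1
      have : subdivVertex t e (k + 1 + 1) = Sum.inl e.1.2 := by
        rw [h2]
        exact subdivVertex_last t e
      rw [this]
      exact ⟨by simp, Or.inr (Or.inr ⟨rfl, h2⟩)⟩

/-- Every edge of a subdivision lies on one of the paths. -/
lemma exists_subdivVertex_of_subdivRel {x y : Fin n ⊕ Σ e : Edges H, Fin (t e)}
    (h : subdivRel H t x y) :
    ∃ e k, k ≤ t e ∧ (x = subdivVertex t e k ∧ y = subdivVertex t e (k + 1) ∨
      y = subdivVertex t e k ∧ x = subdivVertex t e (k + 1)) := by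
  rcases x with u | ⟨e, i⟩ <;> rcases y with v | ⟨e', j⟩
  · obtain ⟨huv, h0⟩ := h
    refine ⟨⟨(u, v), huv⟩, 0, by omega, Or.inl ⟨rfl, ?_⟩⟩
    have := subdivVertex_last t ⟨(u, v), huv⟩
    rw [h0] at this
    rw [this]
  · rcases h with ⟨h, h0⟩ | ⟨h, h0⟩
    · refine ⟨e', 0, by omega, Or.inl ⟨by rw [h, subdivVertex_zero], ?_⟩⟩
      have hj := j.2
      rw [h0] at hj
      rw [subdivVertex_succ t e' hj]
      congr 2
      exact Fin.ext h0
    · refine ⟨e', t e', le_rfl, Or.inr ⟨?_, by rw [h, subdivVertex_last]⟩⟩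
      rw [← h0, subdivVertex_succ t e' j.2]
  · exact h.elim
  · obtain ⟨rfl, hij⟩ := h
    refine ⟨e, i + 1, i.2, Or.inl ⟨by rw [subdivVertex_succ t e i.2], ?_⟩⟩
    have hj := j.2
    rw [← hij] at hj
    rw [subdivVertex_succ t e hj]
    congr 2
    exact Fin.ext hij.symm

end subdivVertex

/-- A path of bounded length between nonadjacent vertices contains an induced path. -/
lemma exists_induced_path {V : Type*} (G : SimpleGraph V) (z : ℕ → V) (t : ℕ)
    (hadj : ∀ k ≤ t, G.Adj (z k) (z (k + 1))) (hne : z 0 ≠ z (t + 1))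
    (hnadj : ¬ G.Adj (z 0) (z (t + 1))) :
    ∃ (l : ℕ) (p : ℕ → V), 1 ≤ l ∧ l ≤ t ∧ p 0 = z 0 ∧ p (l + 1) = z (t + 1) ∧
      (∀ i ≤ l + 1, ∃ k ≤ t + 1, p i = z k) ∧ (∀ i ≤ l, G.Adj (p i) (p (i + 1))) ∧
      (∀ i ≤ l + 1, ∀ j ≤ l + 1, p i = p j → i = j) ∧
      (∀ i ≤ l + 1, ∀ j ≤ l + 1, G.Adj (p i) (p j) → i + 1 = j ∨ j + 1 = i) := by
  classical
  let Good : ℕ → Prop := fun L => ∃ p : ℕ → V, p 0 = z 0 ∧ p L = z (t + 1) ∧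
    (∀ i ≤ L, ∃ k ≤ t + 1, p i = z k) ∧ ∀ i < L, G.Adj (p i) (p (i + 1))
  have hex : ∃ L, Good L := ⟨t + 1, z, rfl, rfl, fun i hi => ⟨i, hi, rfl⟩,
    fun i hi => hadj i (Nat.le_of_lt_succ hi)⟩
  have hmin : ∀ L, Good L → Nat.find hex ≤ L := fun L hL => Nat.find_min' hex hL
  have hle : Nat.find hex ≤ t + 1 := hmin _ ⟨z, rfl, rfl, fun i hi => ⟨i, hi, rfl⟩,
    fun i hi => hadj i (Nat.le_of_lt_succ hi)⟩
  obtain ⟨p, hp0, hpL, hpz, hpadj⟩ := Nat.find_spec hex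
  generalize hL : Nat.find hex = L at *
  have hL0 : L ≠ 0 := by
    rintro rfl
    exact hne (hp0.symm.trans hpL)
  have hL1 : L ≠ 1 := by
    rintro rfl
    apply hnadj
    rw [← hp0, ← hpL]
    exact hpadj 0 (by norm_num)
  have shortcut : ∀ i c, i + 1 + c ≤ L → G.Adj (p i) (p (i + 1 + c)) → c = 0 := by
    intro i c hic hadj'
    have := hmin (L - c) ⟨fun k => if k ≤ i then p k else p (k + c), by simpa using hp0, ?_, ?_, ?_⟩
    · omega
    · dsimp only
      rw [if_neg (by omega), Nat.sub_add_cancel (by omega), hpL]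
    · intro k hk
      dsimp only
      split_ifs with h
      · exact hpz k (by omega)
      · exact hpz (k + c) (by omega)
    · intro k hk
      dsimp only
      rcases lt_trichotomy k i with h | rfl | h
      · rw [if_pos h.le, if_pos (by omega)]
        exact hpadj k (by omega)
      · rw [if_pos le_rfl, if_neg (by omega)]
        exact hadj'
      · rw [if_neg (by omega), if_neg (by omega), show k + 1 + c = k + c + 1 by omega]
        exact hpadj (k + c) (by omega)
  have hinj : ∀ i j, i < j → j ≤ L → p i ≠ p j := by
    intro i j hij hj heq
    rcases Nat.lt_or_ge j L with hjL | hjL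
    · have h1 := hpadj j hjL
      rw [← heq] at h1
      have := shortcut i (j - i) (by omega) (by rwa [show i + 1 + (j - i) = j + 1 by omega])
      omega
    · have hjL' : j = L := le_antisymm hj hjL
      subst hjL'
      have := hmin i ⟨p, hp0, heq.trans hpL, fun k hk => hpz k (by omega),
        fun k hk => hpadj k (by omega)⟩
      omega
  have hind : ∀ i j, i < j → j ≤ L → G.Adj (p i) (p j) → i + 1 = j := by
    intro i j hij hj h
    have := shortcut i (j - i - 1) (by omega) (by rwa [show i + 1 + (j - i - 1) = j by omega])
    omega
  have hLL : L - 1 + 1 = L := by omega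
  refine ⟨L - 1, p, by omega, by omega, hp0, by rw [hLL, hpL], by rwa [hLL],
    fun i hi => hpadj i (by omega), ?_, ?_⟩
  · rw [hLL]
    intro i hi j hj heq
    rcases lt_trichotomy i j with h | h | h
    · exact absurd heq (hinj i j h hj)
    · exact h
    · exact absurd heq.symm (hinj j i h hi)
  · rw [hLL]
    intro i hi j hj h
    rcases lt_trichotomy i j with h' | h' | h'
    · exact Or.inl (hind i j h' hj h)
    · rw [h'] at h
      exact absurd h (G.loopless.irrefl _)
    · exact Or.inr (hind j i h' hi h.symm)

open Classical in
/-- Consider a graph all of whose induced `r`-subdivisions come from graphs with average degree at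
most `d`. Then every system of induced paths with `r` internal vertices on an ambient set `Y` of
ends, such that all the adjacencies are along the paths, has at most `d |Y| / 2` paths. -/
lemma card_path_system_le {V : Type*} (G : SimpleGraph V) {r d : ℕ} (hr : 1 ≤ r)
    (hd : ∀ ⦃m : ℕ⦄ (H : SimpleGraph (Fin m)), MemITM r G H → avgDeg H ≤ d)
    {m : ℕ} (F : Finset (Fin m × Fin m)) (φ : Fin m → V) (p : Fin m × Fin m → ℕ → V)
    (Y : Finset (Fin m)) (hY : ∀ e ∈ F, e.1 ∈ Y ∧ e.2 ∈ Y)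
    (hlt : ∀ e ∈ F, e.1 < e.2) (hends : ∀ e ∈ F, p e 0 = φ e.1 ∧ p e (r + 1) = φ e.2)
    (hφ : Function.Injective φ)
    (halong : ∀ e ∈ F, ∀ e' ∈ F, ∀ i, 1 ≤ i → i ≤ r → ∀ j, 1 ≤ j → j ≤ r →
      p e i = p e' j → e = e' ∧ i = j)
    (hbranch : ∀ e ∈ F, ∀ i, 1 ≤ i → i ≤ r → ∀ x ∈ Y, p e i ≠ φ x)
    (hadj : ∀ e ∈ F, ∀ i ≤ r, G.Adj (p e i) (p e (i + 1)))
    (hind : ∀ e ∈ F, ∀ e' ∈ F, ∀ i ≤ r + 1, ∀ j ≤ r + 1, G.Adj (p e i) (p e' j) →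
      ∃ e'' ∈ F, ∃ k ≤ r, (p e i = p e'' k ∧ p e' j = p e'' (k + 1)) ∨
        (p e' j = p e'' k ∧ p e i = p e'' (k + 1))) :
    2 * F.card ≤ d * Y.card := by
  set Y₀ : Finset (Fin m) := F.image Prod.fst ∪ F.image Prod.snd with hY₀
  have hYY : Y₀ ⊆ Y := by
    intro x hx
    simp only [hY₀, Finset.mem_union, Finset.mem_image] at hx
    rcases hx with ⟨e, he, rfl⟩ | ⟨e, he, rfl⟩
    · exact (hY e he).1
    · exact (hY e he).2
  have hmem : ∀ e ∈ F, e.1 ∈ Y₀ ∧ e.2 ∈ Y₀ := by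
    intro e he
    simp only [hY₀, Finset.mem_union, Finset.mem_image]
    exact ⟨Or.inl ⟨e, he, rfl⟩, Or.inr ⟨e, he, rfl⟩⟩
  set n := Y₀.card with hn
  let ι : Fin n ↪o Fin m := Y₀.orderEmbOfFin rfl
  have hι : ∀ i, ι i ∈ Y₀ := fun i => Finset.orderEmbOfFin_mem Y₀ rfl i
  have hιsurj : ∀ x ∈ Y₀, ∃ i, ι i = x := by
    intro x hx
    have : x ∈ Set.range (Y₀.orderEmbOfFin rfl) := by
      rw [Finset.range_orderEmbOfFin]
      exact hx
    exact this
  let H : SimpleGraph (Fin n) :=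
    { Adj := fun i j => (ι i, ι j) ∈ F ∨ (ι j, ι i) ∈ F
      symm := ⟨fun i j h => h.symm⟩
      loopless := ⟨fun i h => by
        rcases h with h | h <;> exact lt_irrefl _ (hlt _ h)⟩ }
  have hHF : ∀ e : Edges H, (ι e.1.1, ι e.1.2) ∈ F := by
    rintro ⟨e, he1, he2⟩
    rcases he2 with h | h
    · exact h
    · exact absurd (ι.lt_iff_lt.1 (hlt _ h)) he1.asymm
  let t : Edges H → ℕ := fun _ => r
  let f : (Fin n ⊕ Σ e : Edges H, Fin (t e)) → V := fun x => match x with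
    | Sum.inl i => φ (ι i)
    | Sum.inr ⟨e, i⟩ => p (ι e.1.1, ι e.1.2) (i + 1)
  have hinj : Function.Injective f := by
    rintro (i | ⟨e, i⟩) (j | ⟨e', j⟩) h
    · rw [ι.injective (hφ h)]
    · exact absurd h.symm (hbranch _ (hHF e') _ (by omega) j.2 _ (hYY (hι i)))
    · exact absurd h (hbranch _ (hHF e) _ (by omega) i.2 _ (hYY (hι j)))
    · obtain ⟨h1, h2⟩ := halong _ (hHF e) _ (hHF e') _ (by omega) i.2 _ (by omega) j.2 h
      rw [Prod.mk.injEq] at h1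
      have : e = e' := Subtype.ext (Prod.ext (ι.injective h1.1) (ι.injective h1.2))
      subst this
      have : i = j := Fin.ext (by omega)
      rw [this]
  have hf : ∀ (e : Edges H) (k : ℕ), k ≤ r + 1 →
      f (subdivVertex t e k) = p (ι e.1.1, ι e.1.2) k := by
    intro e k hk
    rcases k with _ | k
    · rw [subdivVertex_zero]
      exact (hends _ (hHF e)).1.symm
    · rcases Nat.lt_or_ge k r with h | h
      · rw [subdivVertex_succ t e h]
      · have : k = r := by omega
        subst this
        rw [show k + 1 = t e + 1 from rfl, subdivVertex_last]
        exact (hends _ (hHF e)).2.symm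
  have hedge : ∀ e ∈ F, ∃ ε : Edges H, e = (ι ε.1.1, ι ε.1.2) := by
    intro e he
    obtain ⟨i, hi⟩ := hιsurj _ (hmem e he).1
    obtain ⟨j, hj⟩ := hιsurj _ (hmem e he).2
    have heq : e = (ι i, ι j) := Prod.ext hi.symm hj.symm
    have hlt' := hlt e he
    refine ⟨⟨(i, j), ?_, Or.inl (heq ▸ he)⟩, heq⟩
    rw [← hi, ← hj] at hlt'
    exact ι.lt_iff_lt.1 hlt'
  have hpath : ∀ x, ∃ e ∈ F, ∃ k ≤ r + 1, f x = p e k := by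
    rintro (i | ⟨e, i⟩)
    · have := hι i
      simp only [hY₀, Finset.mem_union, Finset.mem_image] at this
      rcases this with ⟨e, he, hei⟩ | ⟨e, he, hei⟩
      · exact ⟨e, he, 0, by omega, by rw [(hends e he).1, hei]⟩
      · exact ⟨e, he, r + 1, le_rfl, by rw [(hends e he).2, hei]⟩
    · exact ⟨_, hHF e, i + 1, by have := i.2; simp only [t] at this; omega, rfl⟩
  have hfadj : ∀ x y, subdivRel H t x y → G.Adj (f x) (f y) := by
    intro x y h
    obtain ⟨e, k, hk, ⟨rfl, rfl⟩ | ⟨rfl, rfl⟩⟩ := exists_subdivVertex_of_subdivRel t h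
    · rw [hf e k (Nat.le_succ_of_le hk), hf e (k + 1) (Nat.succ_le_succ hk)]
      exact hadj _ (hHF e) k hk
    · rw [hf e k (Nat.le_succ_of_le hk), hf e (k + 1) (Nat.succ_le_succ hk)]
      exact (hadj _ (hHF e) k hk).symm
  have hmemITM : MemITM r G H := by
    refine ⟨⟨⟨f, hinj⟩, ?_⟩⟩
    intro x y
    simp only [Function.Embedding.coeFn_mk]
    constructor
    · intro hxy
      obtain ⟨e, he, i, hi, hx⟩ := hpath x
      obtain ⟨e', he', j, hj, hy⟩ := hpath y
      rw [hx, hy] at hxy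
      obtain ⟨e'', he'', k, hk, h⟩ := hind e he e' he' i hi j hj hxy
      obtain ⟨ε, rfl⟩ := hedge e'' he''
      rw [← hf ε k (by omega), ← hf ε (k + 1) (by omega), ← hx, ← hy] at h
      rcases h with ⟨h1, h2⟩ | ⟨h1, h2⟩
      · rw [hinj h1, hinj h2]
        exact subdivVertex_adj t ε hk
      · rw [hinj h1, hinj h2]
        exact (subdivVertex_adj t ε hk).symm
    · intro hxy
      rw [Subdiv, SimpleGraph.fromRel_adj] at hxy
      rcases hxy.2 with h | h
      · exact hfadj x y h
      · exact (hfadj y x h).symm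
  have havg := hd H hmemITM
  have hcard : F.card ≤ H.edgeSet.ncard := by
    rw [edgeSet_ncard_eq_card_pairs, ← Set.ncard_coe_finset]
    have : (F : Set (Fin m × Fin m)) ⊆ (fun e : Fin n × Fin n => (ι e.1, ι e.2)) ''
        {e : Fin n × Fin n | e.1 < e.2 ∧ H.Adj e.1 e.2} := by
      intro e he
      obtain ⟨ε, rfl⟩ := hedge e he
      exact ⟨ε.1, ε.2, rfl⟩
    exact (Set.ncard_le_ncard this).trans (Set.ncard_image_le)
  rcases Nat.eq_zero_or_pos n with h0 | h0
  · have : F = ∅ := by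
      apply Finset.eq_empty_of_forall_notMem
      intro e he
      have := (hmem e he).1
      rw [Finset.card_eq_zero.1 h0] at this
      simp at this
    simp [this]
  · rw [avgDeg, div_le_iff₀ (by exact_mod_cast h0)] at havg
    have h1 : 2 * H.edgeSet.ncard ≤ d * n := by exact_mod_cast havg
    have h2 : n ≤ Y.card := Finset.card_le_card hYY
    have h3 := Nat.mul_le_mul_left d h2
    omega

/-! ## Dense bipartite graphs -/

open Classical in
/-- The set of neighbours of a vertex. -/
noncomputable def nbr {n : ℕ} (G : SimpleGraph (Fin n)) (v : Fin n) : Finset (Fin n) :=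
  Finset.univ.filter (G.Adj v)

lemma mem_nbr {n : ℕ} {G : SimpleGraph (Fin n)} {v w : Fin n} : w ∈ nbr G v ↔ G.Adj v w := by
  simp [nbr]

/-- A set of pairwise nonadjacent vertices. -/
def Indep {V : Type*} (G : SimpleGraph V) (A : Finset V) : Prop :=
  ∀ x ∈ A, ∀ y ∈ A, ¬ G.Adj x y

/-- `G` has no induced complete bipartite subgraph `K_{s,s}`. -/
def InducedBicliqueFree {V : Type*} (G : SimpleGraph V) (s : ℕ) : Prop :=
  ∀ A B : Finset V, A.card = s → B.card = s → Indep G A → Indep G B →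
    ¬ ∀ a ∈ A, ∀ b ∈ B, G.Adj a b

/-- The pairs of vertices of `U` having a common neighbour of small degree in `A` are few. -/
lemma card_pairs_common_nbr_le {n : ℕ} {G : SimpleGraph (Fin n)} {d : ℕ}
    (hd : ∀ ⦃m : ℕ⦄ (H : SimpleGraph (Fin m)), MemITM 1 G H → avgDeg H ≤ d)
    {A U : Finset (Fin n)} (hA : Indep G A) (hU : Indep G U) {s : ℕ}
    (F : Finset (Fin n × Fin n)) (a : Fin n × Fin n → Fin n)
    (hF : ∀ e ∈ F, e.1 ∈ U ∧ e.2 ∈ U ∧ e.1 < e.2)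
    (ha : ∀ e ∈ F, a e ∈ A ∧ G.Adj (a e) e.1 ∧ G.Adj (a e) e.2 ∧ (nbr G (a e) ∩ U).card ≤ s) :
    2 * F.card ≤ 2 ^ s * d * U.card := by
  have hsub : ∀ e ∈ F, ({e.1, e.2} : Finset (Fin n)) ⊆ nbr G (a e) ∩ U := by
    intro e he x hx
    simp only [Finset.mem_insert, Finset.mem_singleton] at hx
    rw [Finset.mem_inter, mem_nbr]
    rcases hx with rfl | rfl
    · exact ⟨(ha e he).2.1, (hF e he).1⟩
    · exact ⟨(ha e he).2.2.1, (hF e he).2.1⟩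
  obtain ⟨X, hX⟩ := exists_subset_separating F (fun e => {e.1, e.2})
    (fun e => (nbr G (a e) ∩ U) \ {e.1, e.2}) s (fun e _ => Finset.disjoint_sdiff)
    (fun e he => by
      rw [add_comm, Finset.card_sdiff_add_card_eq_card (hsub e he)]
      exact (ha e he).2.2.2)
  set F' := F.filter fun e => {e.1, e.2} ⊆ X ∧ Disjoint ((nbr G (a e) ∩ U) \ {e.1, e.2}) X
    with hF'
  have hmem : ∀ e ∈ F', e ∈ F ∧ e.1 ∈ X ∧ e.2 ∈ X ∧
      ∀ y ∈ U, y ∈ X → G.Adj (a e) y → y = e.1 ∨ y = e.2 := by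
    intro e he
    rw [hF', Finset.mem_filter] at he
    refine ⟨he.1, he.2.1 (by simp), he.2.1 (by simp), ?_⟩
    intro y hyU hyX hy
    by_contra hcon
    exact Finset.disjoint_left.1 he.2.2 (by
      simp only [Finset.mem_sdiff, Finset.mem_inter, mem_nbr, Finset.mem_insert,
        Finset.mem_singleton]
      exact ⟨⟨hy, hyU⟩, hcon⟩) hyX
  have haU : ∀ e ∈ F, a e ∉ U := fun e he hx => hU _ hx _ (hF e he).1 (ha e he).2.1
  have key : 2 * F'.card ≤ d * U.card := by
    apply card_path_system_le G le_rfl hd F' id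
      (fun e k => if k = 0 then e.1 else if k = 1 then a e else e.2) U
    · intro e he
      exact ⟨(hF e (hmem e he).1).1, (hF e (hmem e he).1).2.1⟩
    · intro e he
      exact (hF e (hmem e he).1).2.2
    · intro e he
      simp
    · exact Function.injective_id
    · intro e he e' he' i hi hi' j hj hj' h
      obtain rfl : i = 1 := le_antisymm hi' hi
      obtain rfl : j = 1 := le_antisymm hj' hj
      refine ⟨?_, rfl⟩
      simp only [one_ne_zero, if_false, if_true] at h
      obtain ⟨h0, h1, h2, h3⟩ := hmem e he
      obtain ⟨k0, k1, k2, k3⟩ := hmem e' he'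
      have l1 := (hF e h0)
      have l2 := (hF e' k0)
      have m1 := k3 e.1 l1.1 h1 (h ▸ (ha e h0).2.1)
      have m2 := k3 e.2 l1.2.1 h2 (h ▸ (ha e h0).2.2.1)
      have l1' := l1.2.2
      have l2' := l2.2.2
      rcases m1 with m1 | m1 <;> rcases m2 with m2 | m2
      · rw [m1, m2] at l1'
        exact absurd l1' (lt_irrefl _)
      · exact Prod.ext m1 m2
      · rw [m1, m2] at l1'
        exact absurd l1' l2'.asymm
      · rw [m1, m2] at l1'
        exact absurd l1' (lt_irrefl _)
    · intro e he i hi hi' x hx h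
      obtain rfl : i = 1 := le_antisymm hi' hi
      simp only [one_ne_zero, if_false, if_true, id] at h
      exact haU e (hmem e he).1 (h ▸ hx)
    · intro e he i hi
      have := ha e (hmem e he).1
      interval_cases i
      · simpa using this.2.1.symm
      · simpa using this.2.2.1
    · have main : ∀ e ∈ F', ∀ e' ∈ F', ∀ j ≤ 2, j ≠ 1 →
          G.Adj (a e) (if j = 0 then e'.1 else if j = 1 then a e' else e'.2) →
          (if j = 0 then e'.1 else if j = 1 then a e' else e'.2) = e.1 ∨
          (if j = 0 then e'.1 else if j = 1 then a e' else e'.2) = e.2 := by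
        intro e he e' he' j hj hj1 h
        obtain ⟨k0, k1, k2, k3⟩ := hmem e' he'
        apply (hmem e he).2.2.2 _ _ _ h
        · split_ifs
          · exact (hF e' k0).1
          · exact (hF e' k0).2.1
        · split_ifs
          · exact k1
          · exact k2
      intro e he e' he' i hi j hj h
      have hBmem : ∀ e ∈ F', ∀ j ≠ 1,
          (if j = 0 then e.1 else if j = 1 then a e else e.2) ∈ U := by
        intro e he j hj
        split_ifs
        · exact (hF e (hmem e he).1).1
        · exact (hF e (hmem e he).1).2.1
      by_cases hi1 : i = 1 <;> by_cases hj1 : j = 1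
      · subst hi1 hj1
        simp only [one_ne_zero, if_false, if_true] at h
        exact absurd h (hA _ (ha e (hmem e he).1).1 _ (ha e' (hmem e' he').1).1)
      · subst hi1
        simp only [one_ne_zero, if_false, if_true] at h
        rcases main e he e' he' j hj hj1 h with h1 | h1
        · refine ⟨e, he, 0, by omega, Or.inr ⟨?_, ?_⟩⟩
          · simpa using h1
          · simp
        · refine ⟨e, he, 1, by omega, Or.inl ⟨?_, ?_⟩⟩
          · simp
          · simpa using h1
      · subst hj1
        simp only [one_ne_zero, if_false, if_true] at h
        rcases main e' he' e he i hi hi1 h.symm with h1 | h1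
        · refine ⟨e', he', 0, by omega, Or.inl ⟨?_, ?_⟩⟩
          · simpa using h1
          · simp
        · refine ⟨e', he', 1, by omega, Or.inr ⟨?_, ?_⟩⟩
          · simp
          · simpa using h1
      · exact absurd h (hU _ (hBmem e he i hi1) _ (hBmem e' he' j hj1))
  calc 2 * F.card ≤ 2 * (2 ^ s * F'.card) := Nat.mul_le_mul_left 2 hX
    _ = 2 ^ s * (2 * F'.card) := by ring
    _ ≤ 2 ^ s * (d * U.card) := Nat.mul_le_mul_left _ key
    _ = 2 ^ s * d * U.card := by ring

/-- The number of vertices of `A` with exactly `s` neighbours in `S` is linear in `|S|`. -/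
lemma card_filter_degree_eq_le {n : ℕ} {G : SimpleGraph (Fin n)} {d s : ℕ} (hs : 1 ≤ s)
    (hd : ∀ ⦃m : ℕ⦄ (H : SimpleGraph (Fin m)), MemITM 1 G H → avgDeg H ≤ d)
    (hK : InducedBicliqueFree G s)
    {A S : Finset (Fin n)} (hA : Indep G A) (hS : Indep G S) :
    (A.filter fun a => (nbr G a ∩ S).card = s).card ≤ s * 2 ^ (2 ^ s * d) * S.card := by
  classical
  set A' := A.filter fun a => (nbr G a ∩ S).card = s with hA'
  let Sh : SimpleGraph (Fin n) :=
    { Adj := fun x y => x ≠ y ∧ ∃ a ∈ A', G.Adj a x ∧ G.Adj a y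
      symm := ⟨fun x y ⟨h, a, ha, hx, hy⟩ => ⟨h.symm, a, ha, hy, hx⟩⟩
      loopless := ⟨fun x h => h.1 rfl⟩ }
  have hdeg : DegenerateOn Sh S (2 ^ s * d) := by
    apply degenerateOn_of_card_pairs_le
    intro U hU
    have hex : ∀ e : Fin n × Fin n, ∃ a, Sh.Adj e.1 e.2 → a ∈ A' ∧ G.Adj a e.1 ∧ G.Adj a e.2 := by
      intro e
      by_cases h : Sh.Adj e.1 e.2
      · obtain ⟨_, a, ha⟩ := h
        exact ⟨a, fun _ => ha⟩
      · exact ⟨e.1, fun h' => absurd h' h⟩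
    choose a ha using hex
    refine card_pairs_common_nbr_le (U := U) (A := A) hd hA
      (fun x hx y hy => hS x (hU hx) y (hU hy)) _ a ?_ ?_
    · intro e he
      simp only [Finset.mem_filter, Finset.mem_product] at he
      exact ⟨he.1.1, he.1.2, he.2.1⟩
    · intro e he
      simp only [Finset.mem_filter, Finset.mem_product] at he
      obtain ⟨h1, h2, h3⟩ := ha e he.2.2
      rw [hA', Finset.mem_filter] at h1
      refine ⟨h1.1, h2, h3, ?_⟩
      rw [← h1.2]
      exact Finset.card_le_card (Finset.inter_subset_inter_left hU)
  have hcl := hdeg.card_cliques_le (A'.image fun a => nbr G a ∩ S) (by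
    intro T hT
    obtain ⟨a, ha, rfl⟩ := Finset.mem_image.1 hT
    refine ⟨Finset.inter_subset_right, ?_, ?_⟩
    · rw [← Finset.card_pos, (Finset.mem_filter.1 ha).2]
      exact hs
    · intro x hx y hy hxy
      rw [Finset.mem_inter, mem_nbr] at hx hy
      exact ⟨hxy, a, ha, hx.1, hy.1⟩)
  have hfib := Finset.card_le_mul_card_image (f := fun a => nbr G a ∩ S) A' s (by
    intro T hT
    obtain ⟨a, ha, rfl⟩ := Finset.mem_image.1 hT
    by_contra! hcon
    obtain ⟨R, hR, hRs⟩ := Finset.exists_subset_card_eq hcon.le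
    refine hK R (nbr G a ∩ S) hRs (Finset.mem_filter.1 ha).2 ?_ ?_ ?_
    · intro x hx y hy
      exact hA x (Finset.mem_filter.1 (Finset.mem_filter.1 (hR hx)).1).1
        y (Finset.mem_filter.1 (Finset.mem_filter.1 (hR hy)).1).1
    · intro x hx y hy
      exact hS x (Finset.mem_inter.1 hx).2 y (Finset.mem_inter.1 hy).2
    · intro x hx y hy
      have := (Finset.mem_filter.1 (hR hx)).2
      rw [← this, Finset.mem_inter, mem_nbr] at hy
      exact hy.1)
  calc A'.card ≤ s * (A'.image fun a => nbr G a ∩ S).card := hfib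
    _ ≤ s * (2 ^ (2 ^ s * d) * S.card) := Nat.mul_le_mul_left _ hcl
    _ = s * 2 ^ (2 ^ s * d) * S.card := by ring

/-- The number of vertices of `A` with at least `s` neighbours in `S` is linear in `|S|`. -/
lemma card_filter_le_degree_le {n : ℕ} {G : SimpleGraph (Fin n)} {d s : ℕ} (hs : 1 ≤ s)
    (hd : ∀ ⦃m : ℕ⦄ (H : SimpleGraph (Fin m)), MemITM 1 G H → avgDeg H ≤ d)
    (hK : InducedBicliqueFree G s)
    {A B : Finset (Fin n)} (hA : Indep G A) (hB : Indep G B) :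
    ((A.filter fun a => s ≤ (nbr G a ∩ B).card).card : ℝ)
      ≤ (s * (s * 2 ^ (2 ^ s * d)) : ℕ) * B.card := by
  have := sum_le_of_random_removal A (nbr G) B (fun k => if s ≤ k then 1 else 0)
    (by simp; omega) (s * (s * 2 ^ (2 ^ s * d)) : ℕ) ?_ B subset_rfl
  · simpa [Finset.sum_boole] using this
  · intro S hS
    have h1 := card_filter_degree_eq_le hs hd hK hA (fun x hx y hy => hB x (hS hx) y (hS hy))
    calc _ = ∑ a ∈ A, if (nbr G a ∩ S).card = s then (s : ℝ) else 0 := by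
          apply Finset.sum_congr rfl
          intro a _
          generalize (nbr G a ∩ S).card = k
          by_cases hk : k = s
          · subst hk
            rw [if_pos le_rfl, if_neg (by omega), if_pos rfl]
            ring
          · rw [if_neg hk]
            by_cases hk' : s ≤ k
            · rw [if_pos hk', if_pos (by omega)]
              ring
            · rw [if_neg hk', if_neg (by omega)]
              ring
      _ = s * (A.filter fun a => (nbr G a ∩ S).card = s).card := by
          rw [← Finset.sum_filter, Finset.sum_const, nsmul_eq_mul, mul_comm]
      _ ≤ _ := by
          have h2 := Nat.mul_le_mul_left s h1
          have h3 : s * (s * 2 ^ (2 ^ s * d) * S.card) = s * (s * 2 ^ (2 ^ s * d)) * S.card := by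
            ring
          rw [h3] at h2
          exact_mod_cast h2

/-- If all the vertices of `A` have large degree in `B`, then `A` is much smaller than `B`. -/
lemma exists_degree_card_lt (d s K : ℕ) (hs : 1 ≤ s) : ∃ D : ℕ, 1 ≤ D ∧
    ∀ ⦃n : ℕ⦄ (G : SimpleGraph (Fin n)),
    (∀ ⦃m : ℕ⦄ (H : SimpleGraph (Fin m)), MemITM 1 G H → avgDeg H ≤ d) →
    InducedBicliqueFree G s → ∀ A B : Finset (Fin n), Indep G A → Indep G B → A.Nonempty →
    (∀ a ∈ A, D ≤ (nbr G a ∩ B).card) → K * A.card < B.card := by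
  set C : ℕ := s * (s * 2 ^ (2 ^ s * d)) with hC
  let h : ℕ → ℝ := fun k => ∑ i ∈ Finset.range k, (1 / ((i : ℝ) + 1))
  have hmono : Monotone h := by
    intro a b hab
    apply Finset.sum_le_sum_of_subset_of_nonneg (Finset.range_mono hab)
    intro i _ _
    positivity
  obtain ⟨D, hD1, hD2⟩ := ((Real.tendsto_sum_range_one_div_nat_succ_atTop.eventually_gt_atTop
    (C * K + h s)).and (Filter.eventually_ge_atTop (max s 1))).exists
  have hsD : s ≤ D := (le_max_left _ _).trans hD2
  refine ⟨D, (le_max_right _ _).trans hD2, ?_⟩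
  intro n G hd hK A B hA hB hne hdeg
  have hlin := sum_le_of_random_removal A (nbr G) B (fun k => h (max k s) - h s) (by simp) C ?_ B
    subset_rfl
  · by_contra! hcon
    have h1 : ∑ _a ∈ A, ((C : ℝ) * K) < ∑ a ∈ A, (h (max (nbr G a ∩ B).card s) - h s) := by
      apply Finset.sum_lt_sum_of_nonempty hne
      intro a ha
      have := hmono ((hdeg a ha).trans (le_max_left _ s))
      have : (C : ℝ) * K + h s < h D := hD1
      linarith
    rw [Finset.sum_const, nsmul_eq_mul] at h1
    have h2 : (C : ℝ) * B.card ≤ C * (K * A.card) :=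
      mul_le_mul_of_nonneg_left (by exact_mod_cast hcon) (by positivity)
    linarith
  · intro S hS
    refine le_trans ?_ (card_filter_le_degree_le hs hd hK hA
      (fun x hx y hy => hB x (hS hx) y (hS hy)))
    rw [Finset.card_filter, Nat.cast_sum]
    apply Finset.sum_le_sum
    intro a _
    generalize (nbr G a ∩ S).card = k
    rcases Nat.lt_or_ge s k with hk | hk
    · obtain ⟨k, rfl⟩ : ∃ j, k = j + 1 := ⟨k - 1, by omega⟩
      rw [max_eq_left hk.le, Nat.add_sub_cancel, max_eq_left (Nat.le_of_lt_succ hk), if_pos hk.le]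
      simp only [h, Finset.sum_range_succ]
      have : ((k : ℝ) + 1) ≠ 0 := by positivity
      push_cast
      apply le_of_eq
      field_simp
      ring
    · rw [max_eq_right hk, max_eq_right (by omega), sub_self, mul_zero]
      positivity

lemma exists_degenerateOn_of_colorable (c d s : ℕ) (hs : 1 ≤ s) : ∃ q : ℕ,
    ∀ ⦃n : ℕ⦄ (G : SimpleGraph (Fin n)),
    (∀ ⦃m : ℕ⦄ (H : SimpleGraph (Fin m)), MemITM 1 G H → avgDeg H ≤ d) →
    InducedBicliqueFree G s → G.Colorable c → DegenerateOn G Finset.univ q := by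
  obtain ⟨D, -, hD⟩ := exists_degree_card_lt d s c hs
  refine ⟨c * D, ?_⟩
  intro n G hd hK ⟨κ⟩ U _ hne
  classical
  by_contra! hcon
  let W : Fin c → Finset (Fin n) := fun i => U.filter fun v => κ v = i
  have hW : ∀ i, Indep G (W i) := by
    intro i x hx y hy hxy
    exact κ.valid hxy ((Finset.mem_filter.1 hx).2.trans (Finset.mem_filter.1 hy).2.symm)
  obtain ⟨v₀, hv₀⟩ := hne
  obtain ⟨i, -, hi⟩ := Finset.exists_max_image Finset.univ (fun i => (W i).card)
    ⟨κ v₀, Finset.mem_univ _⟩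
  have hpos : 0 < (W i).card := by
    refine lt_of_lt_of_le ?_ (hi (κ v₀) (Finset.mem_univ _))
    exact Finset.card_pos.2 ⟨v₀, by simp [W, hv₀]⟩
  let A : Fin c → Finset (Fin n) := fun j => (W i).filter fun a => D ≤ (nbr G a ∩ W j).card
  have hA : ∀ j, (A j).Nonempty → c * (A j).card < (W i).card := by
    intro j hj
    refine lt_of_lt_of_le (hD G hd hK (A j) (W j) ?_ (hW j) hj ?_) (hi j (Finset.mem_univ _))
    · intro x hx y hy
      exact hW i x (Finset.mem_filter.1 hx).1 y (Finset.mem_filter.1 hy).1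
    · intro a ha
      exact (Finset.mem_filter.1 ha).2
  have hcover : W i ⊆ Finset.univ.biUnion A := by
    intro a ha
    by_contra hno
    have hlt : ∀ j, (nbr G a ∩ W j).card ≤ D := by
      intro j
      by_contra! h
      exact hno (Finset.mem_biUnion.2 ⟨j, Finset.mem_univ _, Finset.mem_filter.2 ⟨ha, h.le⟩⟩)
    have h1 := hcon a (Finset.mem_filter.1 ha).1
    have h2 : {w | w ∈ U ∧ G.Adj a w} =
        ((Finset.univ.biUnion fun j => nbr G a ∩ W j : Finset (Fin n)) : Set (Fin n)) := by
      ext w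
      simp [mem_nbr, W, and_comm]
    rw [h2, Set.ncard_coe_finset] at h1
    have h3 := (Finset.card_biUnion_le (s := Finset.univ) (t := fun j => nbr G a ∩ W j)).trans
      (Finset.sum_le_sum fun j _ => hlt j)
    simp at h3
    omega
  have h1 := (Finset.card_le_card hcover).trans Finset.card_biUnion_le
  have h2 : ∑ j, c * (A j).card < ∑ _j : Fin c, (W i).card := by
    apply Finset.sum_lt_sum_of_nonempty ⟨κ v₀, Finset.mem_univ _⟩
    intro j _
    rcases (A j).eq_empty_or_nonempty with h | h
    · simpa [h] using Finset.card_pos.1 hpos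
    · exact hA j h
  rw [← Finset.mul_sum, Finset.sum_const, Finset.card_univ, Fintype.card_fin, smul_eq_mul] at h2
  exact absurd (Nat.mul_le_mul_left c h1) (not_le.2 h2)

/-! ## From topological minors to induced topological minors -/

/-- In a degenerate graph, a system of induced paths with `l` internal vertices, which are disjoint
apart from their ends, is small if so are the average degrees of the graphs having an induced
`l`-subdivision. -/
lemma card_disjoint_path_system_le {n : ℕ} {G : SimpleGraph (Fin n)} {q l d : ℕ}
    (hG : DegenerateOn G Finset.univ q) (hl : 1 ≤ l)
    (hd : ∀ ⦃m : ℕ⦄ (H : SimpleGraph (Fin m)), MemITM l G H → avgDeg H ≤ d)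
    {m : ℕ} (F : Finset (Fin m × Fin m)) (φ : Fin m → Fin n) (p : Fin m × Fin m → ℕ → Fin n)
    (hlt : ∀ e ∈ F, e.1 < e.2) (hends : ∀ e ∈ F, p e 0 = φ e.1 ∧ p e (l + 1) = φ e.2)
    (hφ : Function.Injective φ)
    (hdisj : ∀ e ∈ F, ∀ e' ∈ F, ∀ i, 1 ≤ i → i ≤ l → ∀ j, 1 ≤ j → j ≤ l →
      p e i = p e' j → e = e')
    (hbranch : ∀ e ∈ F, ∀ i, 1 ≤ i → i ≤ l → ∀ x, p e i ≠ φ x)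
    (hadj : ∀ e ∈ F, ∀ i ≤ l, G.Adj (p e i) (p e (i + 1)))
    (hinj : ∀ e ∈ F, ∀ i ≤ l + 1, ∀ j ≤ l + 1, p e i = p e j → i = j)
    (hind : ∀ e ∈ F, ∀ i ≤ l + 1, ∀ j ≤ l + 1, G.Adj (p e i) (p e j) → i + 1 = j ∨ j + 1 = i) :
    2 * F.card ≤ 2 ^ ((l + 2) * (q + 1)) * d * m := by
  obtain ⟨out, hout, hor⟩ := hG.exists_orientation
  let P : Fin m × Fin m → Finset (Fin n) := fun e => (Finset.range (l + 2)).image (p e)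
  have hP : ∀ e, (P e).card ≤ l + 2 := fun e => by
    simpa using Finset.card_image_le (s := Finset.range (l + 2)) (f := p e)
  have hPm : ∀ e, ∀ i ≤ l + 1, p e i ∈ P e := fun e i hi =>
    Finset.mem_image.2 ⟨i, Finset.mem_range.2 (by omega), rfl⟩
  obtain ⟨X, hX⟩ := exists_subset_separating F P (fun e => (P e).biUnion out \ P e)
    ((l + 2) * (q + 1)) (fun e _ => Finset.disjoint_sdiff) (fun e _ => by
      have h1 : ((P e).biUnion out \ P e).card ≤ (P e).card * q :=
        (Finset.card_le_card Finset.sdiff_subset).trans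
          (Finset.card_biUnion_le_card_mul _ _ _ fun x _ => hout x)
      have h2 := Nat.mul_le_mul_right q (hP e)
      have h3 := hP e
      rw [mul_add, mul_one]
      omega)
  set F' := F.filter fun e => P e ⊆ X ∧ Disjoint ((P e).biUnion out \ P e) X with hF'
  have hmem : ∀ e ∈ F', e ∈ F ∧ P e ⊆ X ∧ ∀ x ∈ P e, ∀ y ∈ X, y ∈ out x → y ∈ P e := by
    intro e he
    rw [hF', Finset.mem_filter] at he
    refine ⟨he.1, he.2.1, ?_⟩
    intro x hx y hyX hy
    by_contra hcon
    exact Finset.disjoint_left.1 he.2.2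
      (Finset.mem_sdiff.2 ⟨Finset.mem_biUnion.2 ⟨x, hx, hy⟩, hcon⟩) hyX
  have main : ∀ e ∈ F', ∀ e' ∈ F', ∀ i ≤ l + 1, ∀ j ≤ l + 1, p e' j ∈ out (p e i) →
      G.Adj (p e i) (p e' j) → ∃ k ≤ l, (p e i = p e k ∧ p e' j = p e (k + 1)) ∨
        (p e' j = p e k ∧ p e i = p e (k + 1)) := by
    intro e he e' he' i hi j hj hmo h
    obtain ⟨heF, -, h3⟩ := hmem e he
    have h4 := h3 _ (hPm e i hi) _ ((hmem e' he').2.1 (hPm e' j hj)) hmo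
    obtain ⟨k, hk, hkj⟩ := Finset.mem_image.1 h4
    rw [Finset.mem_range] at hk
    rw [← hkj] at h ⊢
    rcases hind e heF i hi k (by omega) h with h5 | h5
    · exact ⟨i, by omega, Or.inl ⟨rfl, by rw [h5]⟩⟩
    · exact ⟨k, by omega, Or.inr ⟨rfl, by rw [h5]⟩⟩
  have key : 2 * F'.card ≤ d * (Finset.univ : Finset (Fin m)).card := by
    apply card_path_system_le G hl hd F' φ p Finset.univ (by simp)
    · exact fun e he => hlt e (hmem e he).1
    · exact fun e he => hends e (hmem e he).1
    · exact hφ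
    · intro e he e' he' i hi hi' j hj hj' h
      have := hdisj e (hmem e he).1 e' (hmem e' he').1 i hi hi' j hj hj' h
      subst this
      exact ⟨rfl, hinj e (hmem e he).1 i (by omega) j (by omega) h⟩
    · exact fun e he i hi hi' x _ => hbranch e (hmem e he).1 i hi hi' x
    · exact fun e he => hadj e (hmem e he).1
    · intro e he e' he' i hi j hj h
      rcases hor _ (Finset.mem_univ _) _ (Finset.mem_univ _) h with h1 | h1
      · obtain ⟨k, hk, h2⟩ := main e he e' he' i hi j hj h1 h
        exact ⟨e, he, k, hk, h2⟩
      · obtain ⟨k, hk, h2⟩ := main e' he' e he j hj i hi h1 h.symm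
        exact ⟨e', he', k, hk, h2.symm⟩
  rw [Finset.card_univ, Fintype.card_fin] at key
  calc 2 * F.card ≤ 2 * (2 ^ ((l + 2) * (q + 1)) * F'.card) := Nat.mul_le_mul_left 2 hX
    _ = 2 ^ ((l + 2) * (q + 1)) * (2 * F'.card) := by ring
    _ ≤ 2 ^ ((l + 2) * (q + 1)) * (d * m) := Nat.mul_le_mul_left _ key
    _ = 2 ^ ((l + 2) * (q + 1)) * d * m := by ring

open Classical in
/-- The density of the shallow topological minors of a degenerate graph is controlled by the average
degrees of the graphs with an exact shallow subdivision as an induced subgraph. -/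
lemma avgDeg_le_of_memTM {n : ℕ} {G : SimpleGraph (Fin n)} {q r : ℕ} (d : ℕ → ℕ)
    (hG : DegenerateOn G Finset.univ q)
    (hd : ∀ l, 1 ≤ l → l ≤ r → ∀ ⦃m : ℕ⦄ (H : SimpleGraph (Fin m)), MemITM l G H → avgDeg H ≤ d l)
    {m : ℕ} (H : SimpleGraph (Fin m)) (hH : MemTM r G H) :
    avgDeg H ≤ (4 * q + ∑ l ∈ Finset.Icc 1 r, 2 ^ ((l + 2) * (q + 1)) * d l : ℕ) := by
  obtain ⟨t, htr, f, hf⟩ := hH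
  let φ : Fin m → Fin n := fun i => f (Sum.inl i)
  have hφ : Function.Injective φ := fun i j h => Sum.inl_injective (hf h)
  set E : Finset (Fin m × Fin m) := Finset.univ.filter fun e => e.1 < e.2 ∧ H.Adj e.1 e.2 with hE
  set E₀ := E.filter fun e => G.Adj (φ e.1) (φ e.2) with hE₀
  set E₁ := E.filter fun e => ¬ G.Adj (φ e.1) (φ e.2) with hE₁
  have hE₀card : E₀.card ≤ 2 * (q * m) := by
    obtain ⟨out, hout, hor⟩ := hG.exists_orientation
    have hpre : ∀ a, (Finset.univ.filter fun b => φ b ∈ out (φ a)).card ≤ q := by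
      intro a
      refine (Finset.card_le_card_of_injOn φ ?_ hφ.injOn).trans (hout (φ a))
      intro b hb
      simpa using hb
    let N : Finset (Fin m × Fin m) := Finset.univ.filter fun e => φ e.2 ∈ out (φ e.1)
    have hN : N.card ≤ q * m := by
      have : N.card = ∑ a, (Finset.univ.filter fun b => φ b ∈ out (φ a)).card := by
        simp only [N, Finset.card_filter, ← Finset.univ_product_univ, Finset.sum_product]
      rw [this]
      refine (Finset.sum_le_sum fun a _ => hpre a).trans ?_
      simp [mul_comm]
    have hsub : E₀ ⊆ N ∪ N.image Prod.swap := by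
      intro e he
      rw [Finset.mem_union]
      rcases hor _ (Finset.mem_univ _) _ (Finset.mem_univ _) (Finset.mem_filter.1 he).2 with h | h
      · left
        simpa [N] using h
      · right
        exact Finset.mem_image.2 ⟨e.swap, by simpa [N] using h, Prod.swap_swap e⟩
    have h1 := (Finset.card_le_card hsub).trans (Finset.card_union_le _ _)
    have h2 := Finset.card_image_le (s := N) (f := Prod.swap)
    omega
  have hex : ∀ e : Fin m × Fin m, ∃ (l : ℕ) (p : ℕ → Fin n), e ∈ E₁ →
      ∃ h : e.1 < e.2 ∧ H.Adj e.1 e.2,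
      (1 ≤ l ∧ l ≤ r) ∧ (p 0 = φ e.1 ∧ p (l + 1) = φ e.2) ∧
      (∀ i, 1 ≤ i → i ≤ l → ∃ k : Fin (t ⟨e, h⟩), p i = f (Sum.inr ⟨⟨e, h⟩, k⟩)) ∧
      (∀ i ≤ l, G.Adj (p i) (p (i + 1))) ∧
      (∀ i ≤ l + 1, ∀ j ≤ l + 1, p i = p j → i = j) ∧
      (∀ i ≤ l + 1, ∀ j ≤ l + 1, G.Adj (p i) (p j) → i + 1 = j ∨ j + 1 = i) := by
    intro e
    by_cases he : e ∈ E₁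
    · have h : e.1 < e.2 ∧ H.Adj e.1 e.2 := by
        simpa [hE] using (Finset.mem_filter.1 he).1
      set ε : Edges H := ⟨e, h⟩ with hε
      have hlast : f (subdivVertex t ε (t ε + 1)) = φ e.2 := by rw [subdivVertex_last]
      obtain ⟨l, p, hl1, hlt, hp0, hpl, hpz, hpadj, hpinj, hpind⟩ :=
        exists_induced_path G (fun k => f (subdivVertex t ε k)) (t ε)
          (fun k hk => f.map_adj (subdivVertex_adj t ε hk))
          (by
            simp only [hlast]
            exact fun h' => h.1.ne (hφ h'))
          (by
            simp only [hlast]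
            exact (Finset.mem_filter.1 he).2)
      refine ⟨l, p, fun _ => ⟨h, ⟨hl1, hlt.trans (htr ε)⟩, ⟨hp0, hpl.trans hlast⟩, ?_, hpadj, hpinj,
        hpind⟩⟩
      intro i hi hi'
      obtain ⟨k, hk, hik⟩ := hpz i (by omega)
      rcases k with _ | k
      · have := hpinj i (by omega) 0 (by omega) (hik.trans hp0.symm)
        omega
      · rcases Nat.lt_or_ge k (t ε) with hkt | hkt
        · refine ⟨⟨k, hkt⟩, ?_⟩
          rw [hik, subdivVertex_succ t ε hkt]
        · have hkt' : k = t ε := by omega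
          subst hkt'
          have := hpinj i (by omega) (l + 1) (by omega) (hik.trans hpl.symm)
          omega
    · exact ⟨0, fun _ => φ e.1, fun h => absurd h he⟩
  choose l p hlp using hex
  have hE₁card : 2 * E₁.card ≤ (∑ k ∈ Finset.Icc 1 r, 2 ^ ((k + 2) * (q + 1)) * d k) * m := by
    have h1 : E₁.card = ∑ k ∈ Finset.Icc 1 r, (E₁.filter fun e => l e = k).card := by
      apply Finset.card_eq_sum_card_fiberwise
      intro e he
      obtain ⟨_, h, _⟩ := hlp e he
      simpa using h
    rw [h1, Finset.mul_sum, Finset.sum_mul]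
    apply Finset.sum_le_sum
    intro k hk
    rw [Finset.mem_Icc] at hk
    have hmem : ∀ e ∈ E₁.filter (fun e => l e = k), e ∈ E₁ ∧ l e = k :=
      fun e he => Finset.mem_filter.1 he
    apply card_disjoint_path_system_le hG hk.1 (hd k hk.1 hk.2) _ φ p
    · intro e he
      obtain ⟨h, -⟩ := hlp e (hmem e he).1
      exact h.1
    · intro e he
      obtain ⟨-, -, h, -⟩ := hlp e (hmem e he).1
      rwa [(hmem e he).2] at h
    · exact hφ
    · intro e he e' he' i hi hi' j hj hj' heq
      obtain ⟨_, -, -, h, -⟩ := hlp e (hmem e he).1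
      obtain ⟨_, -, -, h', -⟩ := hlp e' (hmem e' he').1
      rw [(hmem e he).2] at h
      rw [(hmem e' he').2] at h'
      obtain ⟨a, ha⟩ := h i hi hi'
      obtain ⟨b, hb⟩ := h' j hj hj'
      have := Sum.inr_injective (hf (ha.symm.trans (heq.trans hb)))
      exact congrArg (fun x => x.1.1) this
    · intro e he i hi hi' x hx
      obtain ⟨_, -, -, h, -⟩ := hlp e (hmem e he).1
      rw [(hmem e he).2] at h
      obtain ⟨a, ha⟩ := h i hi hi'
      exact Sum.inr_ne_inl (hf (ha.symm.trans hx))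
    · intro e he
      obtain ⟨-, -, -, -, h, -⟩ := hlp e (hmem e he).1
      rwa [(hmem e he).2] at h
    · intro e he
      obtain ⟨-, -, -, -, -, h, -⟩ := hlp e (hmem e he).1
      rwa [(hmem e he).2] at h
    · intro e he
      obtain ⟨-, -, -, -, -, -, h⟩ := hlp e (hmem e he).1
      rwa [(hmem e he).2] at h
  have hEcard : H.edgeSet.ncard = E.card := by
    rw [edgeSet_ncard_eq_card_pairs, ← Set.ncard_coe_finset]
    congr 1
    ext e
    simp [hE]
  have hsplit : E₀.card + E₁.card = E.card := Finset.card_filter_add_card_filter_not _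
  have htotal : 2 * H.edgeSet.ncard ≤
      (4 * q + ∑ l ∈ Finset.Icc 1 r, 2 ^ ((l + 2) * (q + 1)) * d l) * m := by
    rw [hEcard, ← hsplit, add_mul]
    nlinarith
  rw [avgDeg]
  rcases Nat.eq_zero_or_pos m with h0 | h0
  · subst h0
    simp only [Nat.cast_zero, div_zero]
    positivity
  · rw [div_le_iff₀ (by exact_mod_cast h0)]
    exact_mod_cast htotal

/-! ## Clique numbers and transfer to graphs on `Fin n` -/

lemma omegaNum_le_of_colorable {V : Type*} {G : SimpleGraph V} {k : ℕ} (h : G.Colorable k) :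
    omegaNum G ≤ k := by
  apply csSup_le'
  rintro m ⟨f, -⟩
  have h1 : (⊤ : SimpleGraph (Fin m)).Colorable k := h.of_hom f
  obtain ⟨c⟩ := h1
  have hinj : Function.Injective c := by
    intro i j hij
    by_contra hne
    exact c.valid (show (⊤ : SimpleGraph (Fin m)).Adj i j from hne) hij
  simpa using Fintype.card_le_of_injective c hinj

lemma colorable_chi {n : ℕ} (G : SimpleGraph (Fin n)) : G.Colorable (chi G) := by
  have hne : {N | G.Colorable N}.Nonempty := ⟨n, by simpa using G.colorable_of_fintype⟩
  exact Nat.sInf_mem hne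

lemma Hereditary.exists_iso {C : GraphClass} (hC : Hereditary C) {n : ℕ} {G : SimpleGraph (Fin n)}
    (hG : G ∈ C n) {W : Type*} [Finite W] {K : SimpleGraph W} (h : IsInducedSubgraphOf K G) :
    ∃ (m : ℕ) (K' : SimpleGraph (Fin m)), K' ∈ C m ∧ Nonempty (K' ≃g K) := by
  obtain ⟨m, ⟨e⟩⟩ := Finite.exists_equiv_fin W
  let i : K.comap e.symm ≃g K := SimpleGraph.Iso.comap e.symm K
  obtain ⟨f⟩ := h
  exact ⟨m, K.comap e.symm, hC G _ hG ⟨i.toEmbedding.trans f⟩, ⟨i⟩⟩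

lemma memTM_zero_of_isSubgraphOf {W : Type*} {G : SimpleGraph W} {n : ℕ} {H : SimpleGraph (Fin n)}
    (h : IsSubgraphOf H G) : MemTM 0 G H := by
  obtain ⟨f, hf⟩ := h
  have hno : ∀ x : Σ _e : Edges H, Fin 0, False := fun x => x.2.elim0
  let g : (Fin n ⊕ Σ _e : Edges H, Fin 0) → W := Sum.elim f fun x => (hno x).elim
  have hrel : ∀ x y, subdivRel H (fun _ => 0) x y → G.Adj (g x) (g y) := by
    rintro (u | x) (v | y) hxy
    · obtain ⟨huv, -⟩ := hxy
      exact f.map_adj huv.2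
    · exact (hno y).elim
    · exact (hno x).elim
    · exact (hno x).elim
  refine ⟨fun _ => 0, fun _ => le_rfl, ⟨g, ?_⟩, ?_⟩
  · intro x y hxy
    rw [Subdiv, SimpleGraph.fromRel_adj] at hxy
    rcases hxy.2 with h | h
    · exact hrel x y h
    · exact (hrel y x h).symm
  · rintro (u | x) (v | y) hxy
    · exact congrArg Sum.inl (hf hxy)
    · exact (hno y).elim
    · exact (hno x).elim
    · exact (hno x).elim

/-- Subdividing every edge by at least one vertex yields a `3`-colorable graph. -/
lemma colorable_subdiv {n : ℕ} (H : SimpleGraph (Fin n)) {r : ℕ} (hr : 1 ≤ r) :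
    (Subdiv H fun _ => r).Colorable 3 := by
  let c : (Fin n ⊕ Σ _e : Edges H, Fin r) → Fin 3 := fun x => match x with
    | Sum.inl _ => 0
    | Sum.inr ⟨_, i⟩ => if (i : ℕ) % 2 = 0 then 1 else 2
  have hrel : ∀ x y, subdivRel H (fun _ => r) x y → c x ≠ c y := by
    rintro (u | ⟨e, i⟩) (v | ⟨e', j⟩) h
    · have h0 : r = 0 := h.2
      omega
    · simp only [c]
      split_ifs <;> decide
    · exact h.elim
    · obtain ⟨-, hij⟩ := h
      simp only [c]
      split_ifs
      · omega
      · decide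
      · decide
      · omega
  refine ⟨SimpleGraph.Coloring.mk c ?_⟩
  intro x y hxy
  rw [Subdiv, SimpleGraph.fromRel_adj] at hxy
  rcases hxy.2 with h | h
  · exact hrel x y h
  · exact (hrel y x h).symm

instance {n : ℕ} (H : SimpleGraph (Fin n)) : Finite (Edges H) :=
  inferInstanceAs (Finite {p : Fin n × Fin n // p.1 < p.2 ∧ H.Adj p.1 p.2})

/-- A graph all of whose subgraphs have average degree at most `d` is degenerate. -/
lemma degenerateOn_of_avgDeg_le {n : ℕ} (G : SimpleGraph (Fin n)) (d : ℕ)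
    (h : ∀ ⦃m : ℕ⦄ (H : SimpleGraph (Fin m)), IsSubgraphOf H G → avgDeg H ≤ d) :
    DegenerateOn G Finset.univ d := by
  classical
  apply degenerateOn_of_card_pairs_le
  intro U _
  let ι : Fin U.card ↪o Fin n := U.orderEmbOfFin rfl
  have hsurj : ∀ x ∈ U, ∃ i, ι i = x := by
    intro x hx
    have : x ∈ Set.range (U.orderEmbOfFin rfl) := by
      rw [Finset.range_orderEmbOfFin]
      exact hx
    exact this
  have havg := h (G.comap ι) ⟨⟨ι, fun h => h⟩, ι.injective⟩
  have hcard : ((U ×ˢ U).filter fun e => e.1 < e.2 ∧ G.Adj e.1 e.2).card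
      ≤ (G.comap ι).edgeSet.ncard := by
    rw [edgeSet_ncard_eq_card_pairs, ← Set.ncard_coe_finset]
    refine (Set.ncard_le_ncard ?_).trans
      (Set.ncard_image_le (f := fun e : Fin U.card × Fin U.card => (ι e.1, ι e.2)))
    intro e he
    simp only [Finset.coe_filter, Finset.mem_product, Set.mem_ofPred_eq] at he
    obtain ⟨i, hi⟩ := hsurj _ he.1.1
    obtain ⟨j, hj⟩ := hsurj _ he.1.2
    refine ⟨(i, j), ⟨?_, ?_⟩, Prod.ext hi hj⟩
    · have := he.2.1
      rw [← hi, ← hj] at this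
      exact ι.lt_iff_lt.1 this
    · rw [SimpleGraph.comap_adj, hi, hj]
      exact he.2.2
  rcases Nat.eq_zero_or_pos U.card with h0 | h0
  · rw [Finset.card_eq_zero.1 h0]
    simp
  · rw [avgDeg, div_le_iff₀ (by exact_mod_cast h0)] at havg
    have : 2 * (G.comap ι).edgeSet.ncard ≤ d * U.card := by exact_mod_cast havg
    omega

lemma chi_le_of_avgDeg_le {n : ℕ} (G : SimpleGraph (Fin n)) (d : ℕ)
    (h : ∀ ⦃m : ℕ⦄ (H : SimpleGraph (Fin m)), IsSubgraphOf H G → avgDeg H ≤ d) :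
    chi G ≤ d + 1 := by
  obtain ⟨c, hc⟩ := (degenerateOn_of_avgDeg_le G d h).exists_coloring
  exact Nat.sInf_le ⟨SimpleGraph.Coloring.mk c fun {u v} huv =>
    hc u (Finset.mem_univ u) v (Finset.mem_univ v) huv⟩

lemma avgDeg_eq_of_iso_biclique {n s : ℕ} {G : SimpleGraph (Fin n)}
    (e : G ≃g completeBipartiteGraph (Fin s) (Fin s)) : avgDeg G = s := by
  have hn : n = 2 * s := by
    have := Fintype.card_congr e.toEquiv
    simp at this
    omega
  have hE : G.edgeSet.ncard = s * s := by
    have h1 : G.edgeSet.ncard = (Set.univ : Set (Fin s × Fin s)).ncard := by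
      symm
      apply Set.ncard_congr (fun x _ => s(e.symm (Sum.inl x.1), e.symm (Sum.inr x.2)))
      · intro x _
        rw [SimpleGraph.mem_edgeSet, e.symm.map_adj_iff]
        simp
      · intro x y _ _ h
        rcases Sym2.eq_iff.1 h with h | h
        · exact Prod.ext (Sum.inl_injective (e.symm.injective h.1))
            (Sum.inr_injective (e.symm.injective h.2))
        · exact absurd (e.symm.injective h.1) Sum.inl_ne_inr
      · intro z
        induction z using Sym2.ind with
        | _ x y =>
        intro hxy
        rw [SimpleGraph.mem_edgeSet, ← e.map_adj_iff] at hxy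
        rcases hxy with ⟨h1, h2⟩ | ⟨h1, h2⟩
        · obtain ⟨a, ha⟩ := Sum.isLeft_iff.1 h1
          obtain ⟨b, hb⟩ := Sum.isRight_iff.1 h2
          refine ⟨(a, b), Set.mem_univ _, ?_⟩
          simp only [← ha, ← hb, RelIso.symm_apply_apply]
        · obtain ⟨a, ha⟩ := Sum.isRight_iff.1 h1
          obtain ⟨b, hb⟩ := Sum.isLeft_iff.1 h2
          refine ⟨(b, a), Set.mem_univ _, ?_⟩
          simp only [← ha, ← hb, RelIso.symm_apply_apply]
          exact Sym2.eq_swap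
    rw [h1, Set.ncard_univ]
    simp
  rw [avgDeg, hE, hn]
  rcases Nat.eq_zero_or_pos s with rfl | hs
  · simp
  · have : (s : ℝ) ≠ 0 := by positivity
    push_cast
    field_simp

lemma exists_iso_biclique_of_not_inducedBicliqueFree {C : GraphClass} (hC : Hereditary C) {n s : ℕ}
    {G : SimpleGraph (Fin n)} (hG : G ∈ C n) (h : ¬ InducedBicliqueFree G s) :
    ∃ (m : ℕ) (K : SimpleGraph (Fin m)), K ∈ C m ∧
      Nonempty (K ≃g completeBipartiteGraph (Fin s) (Fin s)) := by
  unfold InducedBicliqueFree at h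
  push Not at h
  obtain ⟨A, B, hAs, hBs, hA, hB, hAB⟩ := h
  let a := A.orderEmbOfFin hAs
  let b := B.orderEmbOfFin hBs
  have ha : ∀ i, a i ∈ A := Finset.orderEmbOfFin_mem A hAs
  have hb : ∀ i, b i ∈ B := Finset.orderEmbOfFin_mem B hBs
  have hab : ∀ i j, G.Adj (a i) (b j) := fun i j => hAB _ (ha i) _ (hb j)
  apply hC.exists_iso hG
  refine ⟨⟨⟨Sum.elim a b, ?_⟩, ?_⟩⟩
  · rintro (i | i) (j | j) hij
    · exact congrArg Sum.inl (a.injective hij)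
    · exact absurd hij (hab i j).ne
    · exact absurd hij (hab j i).ne'
    · exact congrArg Sum.inr (b.injective hij)
  · rintro (i | i) (j | j)
    · change G.Adj (a i) (a j) ↔ _
      simpa using hA _ (ha i) _ (ha j)
    · change G.Adj (a i) (b j) ↔ _
      simpa using hab i j
    · change G.Adj (b i) (a j) ↔ _
      simpa using (hab j i).symm
    · change G.Adj (b i) (b j) ↔ _
      simpa using hB _ (hb i) _ (hb j)

/-- A hereditary class has `ω`-bounded expansion iff it is `χ`-bounded, it
misses some `K_{s,s}`, and `d̄(ITM_r^e(𝒞)) < ∞` for every `r ≥ 1`. -/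
theorem omegaBE_iff (C : GraphClass) (hC : Hereditary C) :
    OmegaBoundedExpansion C ↔
      (ChiBounded C ∧
       (∃ s : ℕ, ¬ ∃ (n : ℕ) (G : SimpleGraph (Fin n)), G ∈ C n ∧
          Nonempty (G ≃g completeBipartiteGraph (Fin s) (Fin s))) ∧
       (∀ r : ℕ, 1 ≤ r → ∃ d : ℝ, ∀ ⦃m : ℕ⦄ (H : SimpleGraph (Fin m)),
          MemITMClass r C H → avgDeg H ≤ d)) := by
  constructor
  · rintro ⟨f, hf⟩
    let B : ℕ → ℕ → ℕ := fun w r => ∑ k ∈ Finset.range (w + 1), ⌈f k r⌉₊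
    have hB : ∀ ⦃n : ℕ⦄ (G : SimpleGraph (Fin n)), G ∈ C n → ∀ (w : ℕ), omegaNum G ≤ w →
        ∀ (r : ℕ) ⦃m : ℕ⦄ (H : SimpleGraph (Fin m)), MemTM r G H → avgDeg H ≤ B w r := by
      intro n G hG w hw r m H hH
      refine (hf G hG r H hH).trans ((Nat.le_ceil _).trans ?_)
      exact_mod_cast Finset.single_le_sum (f := fun k => ⌈f k r⌉₊) (fun _ _ => Nat.zero_le _)
        (Finset.mem_range.2 (Nat.lt_succ_of_le hw))
    refine ⟨⟨fun w => B w 0 + 1, ?_⟩, ⟨B 2 0 + 1, ?_⟩, ?_⟩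
    · intro n G hG m H hH
      exact chi_le_of_avgDeg_le H _ fun k K hK =>
        hB H (hC G H hG hH) _ le_rfl 0 K (memTM_zero_of_isSubgraphOf hK)
    · rintro ⟨n, G, hG, ⟨e⟩⟩
      have hcol : G.Colorable 2 :=
        (SimpleGraph.CompleteBipartiteGraph.bicoloring (Fin (B 2 0 + 1))
          (Fin (B 2 0 + 1))).colorable.of_hom e.toHom
      have h := hB G hG 2 (omegaNum_le_of_colorable hcol) 0 G
        (memTM_zero_of_isSubgraphOf ⟨SimpleGraph.Hom.id, Function.injective_id⟩)
      rw [avgDeg_eq_of_iso_biclique e, Nat.cast_le] at h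
      omega
    · intro r hr
      refine ⟨B 3 r, ?_⟩
      rintro m H ⟨n, G, hG, hH⟩
      obtain ⟨k, K, hK, ⟨e⟩⟩ := hC.exists_iso hG hH
      exact hB K hK 3 (omegaNum_le_of_colorable ((colorable_subdiv H hr).of_hom e.toHom)) r H
        ⟨fun _ => r, fun _ => le_rfl, e.symm.toHom, e.symm.injective⟩
  · rintro ⟨⟨χ, hχ⟩, ⟨s, hs⟩, hITM⟩
    rcases Nat.eq_zero_or_pos s with rfl | hspos
    · refine ⟨fun _ _ => 0, fun n G hG => absurd ?_ hs⟩
      apply exists_iso_biclique_of_not_inducedBicliqueFree hC hG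
      intro h
      exact h ∅ ∅ rfl rfl (by simp [Indep]) (by simp [Indep]) (by simp)
    have hd : ∀ r : ℕ, ∃ d : ℕ, 1 ≤ r → ∀ ⦃m : ℕ⦄ (H : SimpleGraph (Fin m)),
        MemITMClass r C H → avgDeg H ≤ d := by
      intro r
      by_cases hr : 1 ≤ r
      · obtain ⟨d, hd⟩ := hITM r hr
        exact ⟨⌈d⌉₊, fun _ m H hH => (hd H hH).trans (Nat.le_ceil d)⟩
      · exact ⟨0, fun h => absurd h hr⟩
    choose d hd using hd
    choose q hq using fun w => exists_degenerateOn_of_colorable (χ w) (d 1) s hspos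
    refine ⟨fun w r => (4 * q w + ∑ l ∈ Finset.Icc 1 r, 2 ^ ((l + 2) * (q w + 1)) * d l : ℕ), ?_⟩
    intro n G hG r m H hH
    have hITMG : ∀ l, 1 ≤ l → ∀ ⦃m : ℕ⦄ (H : SimpleGraph (Fin m)), MemITM l G H →
        avgDeg H ≤ d l := fun l hl m H hH => hd l hl H ⟨n, G, hG, hH⟩
    have hK : InducedBicliqueFree G s := by
      by_contra hcon
      exact hs (exists_iso_biclique_of_not_inducedBicliqueFree hC hG hcon)
    have hcol : G.Colorable (χ (omegaNum G)) :=
      (colorable_chi G).mono (hχ G hG G ⟨SimpleGraph.Embedding.refl⟩)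
    exact avgDeg_le_of_memTM d (hq _ G (hITMG 1 le_rfl) hK hcol) (fun l hl _ => hITMG l hl) H hH
end

section
/- For an integer i ≥ 0, say that a hereditary class 𝒞 is rank-i χ_p-bounded if for every positive integer p there is a function f_p such that every G ∈ 𝒞 satisfies χ_p(G) ≤ f_p(ω(TM_{min(i,p-1)}(G))). Then a hereditary class 𝒞 is rank-i χ_p-bounded if and only if either i = 0 and 𝒞 is strongly χ_p-bounded for every positive integer p, or i > 0 and 𝒞 is weakly χ_p-bounded for every positive integer p. -/
open SimpleGraph

/-- A `(≤ r)`-subdivision of `K_k` in `G`. For `i < j`, the branch vertices `branch i` and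
`branch j` are joined by the path `path i j 0, …, path i j (len i j + 1)`. -/
structure TopClique {V : Type*} (r : ℕ) (G : SimpleGraph V) (k : ℕ) where
  branch : Fin k → V
  len : Fin k → Fin k → ℕ
  path : Fin k → Fin k → ℕ → V
  len_le : ∀ i j, i < j → len i j ≤ r
  path_zero : ∀ i j, i < j → path i j 0 = branch i
  path_last : ∀ i j, i < j → path i j (len i j + 1) = branch j
  adj : ∀ i j, i < j → ∀ n ≤ len i j, G.Adj (path i j n) (path i j (n + 1))
  branch_injective : Function.Injective branch
  path_ne_branch : ∀ i j, i < j → ∀ n, 1 ≤ n → n ≤ len i j → ∀ l, path i j n ≠ branch l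
  path_injective : ∀ i j, i < j → ∀ i' j', i' < j' → ∀ n, 1 ≤ n → n ≤ len i j →
    ∀ n', 1 ≤ n' → n' ≤ len i' j' → path i j n = path i' j' n' → i = i' ∧ j = j' ∧ n = n'

namespace TopClique

variable {V W : Type*} {r r' k k' : ℕ} {G : SimpleGraph V} {G' : SimpleGraph W}

/-- Restrict a topological clique to some of its branch vertices, following only the positions
`σ i j 0 < σ i j 1 < …` on each path. -/
def reroute (T : TopClique r G k) (e : Fin k' ↪o Fin k) (len' : Fin k' → Fin k' → ℕ)
    (σ : Fin k' → Fin k' → ℕ → ℕ) (hlen : ∀ i j, i < j → len' i j ≤ r')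
    (h0 : ∀ i j, i < j → σ i j 0 = 0)
    (hlast : ∀ i j, i < j → σ i j (len' i j + 1) = T.len (e i) (e j) + 1)
    (hmono : ∀ i j, i < j → StrictMono (σ i j))
    (hadj : ∀ i j, i < j → ∀ n ≤ len' i j,
      G.Adj (T.path (e i) (e j) (σ i j n)) (T.path (e i) (e j) (σ i j (n + 1)))) :
    TopClique r' G k' where
  branch i := T.branch (e i)
  len := len'
  path i j n := T.path (e i) (e j) (σ i j n)
  len_le := hlen
  path_zero i j h := by
    rw [h0 i j h, T.path_zero _ _ (e.strictMono h)]
  path_last i j h := by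
    rw [hlast i j h, T.path_last _ _ (e.strictMono h)]
  adj := hadj
  branch_injective := T.branch_injective.comp e.injective
  path_ne_branch i j h n hn hn' l := by
    have h1 := hmono i j h (show 0 < n by omega)
    have h2 := hmono i j h (show n < len' i j + 1 by omega)
    rw [h0 i j h] at h1
    rw [hlast i j h] at h2
    exact T.path_ne_branch _ _ (e.strictMono h) _ (by omega) (by omega) _
  path_injective i j h i' j' h' n hn hn' m hm hm' heq := by
    have h1 := hmono i j h (show 0 < n by omega)
    have h2 := hmono i j h (show n < len' i j + 1 by omega)
    rw [h0 i j h] at h1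
    rw [hlast i j h] at h2
    have h3 := hmono i' j' h' (show 0 < m by omega)
    have h4 := hmono i' j' h' (show m < len' i' j' + 1 by omega)
    rw [h0 i' j' h'] at h3
    rw [hlast i' j' h'] at h4
    obtain ⟨ha, hb, hc⟩ := T.path_injective _ _ (e.strictMono h) _ _ (e.strictMono h') _
      (by omega) (by omega) _ (by omega) (by omega) heq
    obtain rfl := e.injective ha
    obtain rfl := e.injective hb
    exact ⟨rfl, rfl, (hmono i j h).injective hc⟩

/-- Restriction of a topological clique to some of its branch vertices. -/
def restrict (T : TopClique r G k) (e : Fin k' ↪o Fin k) : TopClique r G k' :=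
  T.reroute e (fun i j => T.len (e i) (e j)) (fun _ _ n => n)
    (fun _ _ h => T.len_le _ _ (e.strictMono h)) (fun _ _ _ => rfl) (fun _ _ _ => rfl)
    (fun _ _ _ => strictMono_id) (fun _ _ h => T.adj _ _ (e.strictMono h))

/-- The image of a topological clique under an injective homomorphism. -/
def map (T : TopClique r G k) (f : G →g G') (hf : Function.Injective f) : TopClique r G' k where
  branch i := f (T.branch i)
  len := T.len
  path i j n := f (T.path i j n)
  len_le := T.len_le
  path_zero i j h := by rw [T.path_zero i j h]
  path_last i j h := by rw [T.path_last i j h]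
  adj i j h n hn := f.map_adj (T.adj i j h n hn)
  branch_injective := hf.comp T.branch_injective
  path_ne_branch i j h n hn hn' l heq := T.path_ne_branch i j h n hn hn' l (hf heq)
  path_injective i j h i' j' h' n hn hn' m hm hm' heq :=
    T.path_injective i j h i' j' h' n hn hn' m hm hm' (hf heq)

/-- A `(≤ r)`-subdivision is a `(≤ r')`-subdivision for `r ≤ r'`. -/
def weaken (T : TopClique r G k) (h : r ≤ r') : TopClique r' G k :=
  { T with len_le := fun i j hij => (T.len_le i j hij).trans h }

theorem memTM (T : TopClique r G k) : MemTM r G (⊤ : SimpleGraph (Fin k)) := by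
  refine ⟨fun e => T.len e.1.1 e.1.2, fun e => T.len_le _ _ e.2.1, ?_⟩
  let f : (Fin k ⊕ Σ e : Edges (⊤ : SimpleGraph (Fin k)), Fin (T.len e.1.1 e.1.2)) → V :=
    Sum.elim T.branch (fun x => T.path x.1.1.1 x.1.1.2 (x.2 + 1))
  have hlt : ∀ (e : Edges (⊤ : SimpleGraph (Fin k))) (n : Fin (T.len e.1.1 e.1.2)),
      (n : ℕ) + 1 ≤ T.len e.1.1 e.1.2 := fun _ n => n.isLt
  have key : ∀ x y, subdivRel (⊤ : SimpleGraph (Fin k)) (fun e => T.len e.1.1 e.1.2) x y →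
      G.Adj (f x) (f y) := by
    rintro (u | ⟨e, n⟩) (v | ⟨e', n'⟩) h
    · obtain ⟨h, h0⟩ := h
      have := T.adj u v h.1 0 (Nat.zero_le _)
      have h1 := T.path_last u v h.1
      simp only at h0
      rw [h0] at h1
      rw [T.path_zero _ _ h.1, h1] at this
      exact this
    · rcases h with ⟨rfl, h⟩ | ⟨rfl, h⟩
      · have := T.adj _ _ e'.2.1 0 (Nat.zero_le _)
        rw [T.path_zero _ _ e'.2.1] at this
        simpa [f, h] using this
      · have := T.adj _ _ e'.2.1 (n' + 1) (hlt e' n')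
        rw [h, T.path_last _ _ e'.2.1] at this
        simpa [f, h] using this.symm
    · exact h.elim
    · obtain ⟨rfl, h⟩ := h
      have := T.adj _ _ e.2.1 (n + 1) (hlt e n)
      rw [h] at this
      simpa [f, h] using this
  refine ⟨⟨f, ?_⟩, ?_⟩
  · intro x y h
    rw [Subdiv, SimpleGraph.fromRel_adj] at h
    exact h.2.elim (key _ _) fun h => (key _ _ h).symm
  · rintro (u | ⟨e, n⟩) (v | ⟨e', n'⟩) h
    · exact congrArg _ (T.branch_injective h)
    · exact (T.path_ne_branch _ _ e'.2.1 (n' + 1) (by omega) (hlt e' n') u h.symm).elim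
    · exact (T.path_ne_branch _ _ e.2.1 (n + 1) (by omega) (hlt e n) v h).elim
    · obtain ⟨h1, h2, h3⟩ := T.path_injective _ _ e.2.1 _ _ e'.2.1 (n + 1) (by omega) (hlt e n)
        (n' + 1) (by omega) (hlt e' n') h
      obtain rfl : e = e' := Subtype.ext (Prod.ext h1 h2)
      obtain rfl : n = n' := Fin.ext (by omega)
      rfl

end TopClique

theorem le_of_isSubgraphOf {n m : ℕ} {H : SimpleGraph (Fin n)} {G : SimpleGraph (Fin m)}
    (h : IsSubgraphOf H G) : n ≤ m := by
  obtain ⟨f, hf⟩ := h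
  simpa using Fintype.card_le_of_injective f hf

theorem le_omegaNum_iff {n k : ℕ} {G : SimpleGraph (Fin n)} :
    k ≤ omegaNum G ↔ IsSubgraphOf (⊤ : SimpleGraph (Fin k)) G := by
  have hbdd : BddAbove {m | IsSubgraphOf (⊤ : SimpleGraph (Fin m)) G} :=
    ⟨n, fun m hm => le_of_isSubgraphOf hm⟩
  refine ⟨fun h => ?_, fun h => le_csSup hbdd h⟩
  have hne : {m | IsSubgraphOf (⊤ : SimpleGraph (Fin m)) G}.Nonempty :=
    ⟨0, ⟨⟨Fin.elim0, fun {a} => a.elim0⟩, fun a => a.elim0⟩⟩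
  obtain ⟨f, hf⟩ := Nat.sSup_mem hne hbdd
  refine ⟨⟨fun i => f (Fin.castLE h i), fun {a b} hab => f.map_adj ?_⟩,
    hf.comp (Fin.castLE_injective h)⟩
  rw [SimpleGraph.top_adj] at hab ⊢
  exact fun h' => hab (Fin.castLE_injective h h')

theorem omegaNum_le {n : ℕ} (G : SimpleGraph (Fin n)) : omegaNum G ≤ n :=
  le_of_isSubgraphOf (le_omegaNum_iff.1 le_rfl)

theorem omegaNum_top (k : ℕ) : omegaNum (⊤ : SimpleGraph (Fin k)) = k :=
  le_antisymm (omegaNum_le _) (le_omegaNum_iff.2 ⟨SimpleGraph.Hom.id, Function.injective_id⟩)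

/-- Cliques can be listed increasingly. -/
theorem IsSubgraphOf.exists_orderEmbedding {n k : ℕ} {H : SimpleGraph (Fin n)}
    (h : IsSubgraphOf (⊤ : SimpleGraph (Fin k)) H) :
    ∃ e : Fin k ↪o Fin n, ∀ i j, i < j → H.Adj (e i) (e j) := by
  classical
  obtain ⟨f, hf⟩ := h
  have hc : (Finset.univ.image f).card = k := by
    rw [Finset.card_image_of_injective _ hf, Finset.card_univ, Fintype.card_fin]
  refine ⟨(Finset.univ.image f).orderEmbOfFin hc, fun i j hij => ?_⟩
  obtain ⟨a, -, ha⟩ := Finset.mem_image.1 (Finset.orderEmbOfFin_mem _ hc i)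
  obtain ⟨b, -, hb⟩ := Finset.mem_image.1 (Finset.orderEmbOfFin_mem _ hc j)
  have hne := ((Finset.univ.image f).orderEmbOfFin hc).injective.ne hij.ne
  rw [← ha, ← hb] at hne ⊢
  exact f.map_adj (fun h => hne (congrArg f h))

theorem MemTM.nonempty_topClique {V : Type*} {r n k : ℕ} {G : SimpleGraph V}
    {H : SimpleGraph (Fin n)} (h : MemTM r G H) (hk : k ≤ omegaNum H) :
    Nonempty (TopClique r G k) := by
  obtain ⟨t, ht, f, hf⟩ := h
  obtain ⟨e, he⟩ := (le_omegaNum_iff.1 hk).exists_orderEmbedding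
  let E : ∀ i j, i < j → Edges H := fun i j h => ⟨(e i, e j), e.strictMono h, he i j h⟩
  have hadj : ∀ x y, x ≠ y → subdivRel H t x y → G.Adj (f x) (f y) := fun x y hne hxy =>
    f.map_adj ((SimpleGraph.fromRel_adj _ _ _).2 ⟨hne, Or.inl hxy⟩)
  have key : ∀ i j, ∃ (L : ℕ) (p : ℕ → V), ∀ h : i < j, L = t (E i j h) ∧
      p 0 = f (Sum.inl (e i)) ∧ p (L + 1) = f (Sum.inl (e j)) ∧
      (∀ n ≤ L, G.Adj (p n) (p (n + 1))) ∧
      ∀ n, 1 ≤ n → n ≤ L → ∃ q : Fin (t (E i j h)), n = q + 1 ∧ p n = f (Sum.inr ⟨E i j h, q⟩) := by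
    intro i j
    by_cases h : i < j
    swap
    · exact ⟨0, fun _ => f (Sum.inl (e i)), fun h' => (h h').elim⟩
    let p : ℕ → V := fun n => if n = 0 then f (Sum.inl (e i)) else
      if hn : n - 1 < t (E i j h) then f (Sum.inr ⟨E i j h, ⟨n - 1, hn⟩⟩) else f (Sum.inl (e j))
    have hp : ∀ (n : ℕ) (hn : n < t (E i j h)), p (n + 1) = f (Sum.inr ⟨E i j h, ⟨n, hn⟩⟩) := by
      intro n hn
      simp [p, hn]
    have hp0 : p 0 = f (Sum.inl (e i)) := by simp [p]
    have hpl : p (t (E i j h) + 1) = f (Sum.inl (e j)) := by simp [p]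
    refine ⟨t (E i j h), p, fun _ => ⟨rfl, hp0, hpl, ?_, ?_⟩⟩
    · intro n hn
      rcases Nat.eq_zero_or_pos n with rfl | hn0
      · rw [hp0]
        rcases Nat.eq_zero_or_pos (t (E i j h)) with h0 | h0
        · rw [h0] at hpl
          rw [hpl]
          exact hadj _ _ (by simpa using h.ne) ⟨⟨e.strictMono h, he i j h⟩, h0⟩
        · rw [hp 0 h0]
          exact hadj _ _ (by simp) (Or.inl ⟨rfl, rfl⟩)
      · obtain ⟨n, rfl⟩ := Nat.exists_eq_add_of_le' hn0
        rw [hp n (by omega)]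
        rcases hn.eq_or_lt with h1 | h1
        · rw [h1, hpl]
          exact (hadj (Sum.inl (e j)) (Sum.inr _) (by simp) (Or.inr ⟨rfl, h1⟩)).symm
        · rw [hp (n + 1) h1]
          exact hadj _ _ (by simp) ⟨rfl, rfl⟩
    · intro n hn hn'
      obtain ⟨n, rfl⟩ := Nat.exists_eq_add_of_le' hn
      exact ⟨⟨n, hn'⟩, rfl, hp n hn'⟩
  choose L p hLp using key
  refine ⟨{
    branch := fun i => f (Sum.inl (e i))
    len := L
    path := p
    len_le := fun i j h => (hLp i j h).1 ▸ ht _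
    path_zero := fun i j h => (hLp i j h).2.1
    path_last := fun i j h => (hLp i j h).2.2.1
    adj := fun i j h => (hLp i j h).2.2.2.1
    branch_injective := fun i j h => e.injective (Sum.inl_injective (hf h))
    path_ne_branch := ?_
    path_injective := ?_ }⟩
  · intro i j h n hn hn' l heq
    obtain ⟨q, -, hq⟩ := (hLp i j h).2.2.2.2 n hn hn'
    rw [hq] at heq
    exact absurd (hf heq) (by simp)
  · intro i j h i' j' h' n hn hn' m hm hm' heq
    obtain ⟨q, hnq, hq⟩ := (hLp i j h).2.2.2.2 n hn hn'
    obtain ⟨q', hmq, hq'⟩ := (hLp i' j' h').2.2.2.2 m hm hm'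
    rw [hq, hq'] at heq
    have h1 := Sum.inr_injective (hf heq)
    have h2 : E i j h = E i' j' h' := congrArg Sigma.fst h1
    have h3 : (q : ℕ) = q' := by
      have := congrArg (fun x : (Σ e : Edges H, Fin (t e)) => (x.2 : ℕ)) h1
      exact this
    have h4 := congrArg Subtype.val h2
    exact ⟨e.injective (congrArg Prod.fst h4), e.injective (congrArg Prod.snd h4), by omega⟩

theorem le_omegaTM_iff {n r k : ℕ} {G : SimpleGraph (Fin n)} :
    k ≤ omegaTM r G ↔ Nonempty (TopClique r G k) := by
  have hbdd : BddAbove {m | ∃ (k : ℕ) (H : SimpleGraph (Fin k)), MemTM r G H ∧ omegaNum H = m} := by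
    refine ⟨n, ?_⟩
    rintro _ ⟨k, H, ⟨t, -, f, hf⟩, rfl⟩
    refine (omegaNum_le H).trans ?_
    simpa using Fintype.card_le_of_injective _ (hf.comp Sum.inl_injective)
  constructor
  · intro h
    have hne : {m | ∃ (k : ℕ) (H : SimpleGraph (Fin k)), MemTM r G H ∧ omegaNum H = m}.Nonempty := by
      refine ⟨_, 0, ⊤, TopClique.memTM (r := r) (G := G) (k := 0) ?_, rfl⟩
      exact ⟨Fin.elim0, Fin.elim0, Fin.elim0, fun i => i.elim0, fun i => i.elim0, fun i => i.elim0,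
        fun i => i.elim0, fun i => i.elim0, fun i => i.elim0, fun i => i.elim0⟩
    obtain ⟨k', H, hH, hk'⟩ := Nat.sSup_mem hne hbdd
    exact hH.nonempty_topClique (h.trans hk'.ge)
  · rintro ⟨T⟩
    exact le_csSup hbdd ⟨k, ⊤, T.memTM, omegaNum_top k⟩

theorem omegaTM_mono {n r r' : ℕ} (h : r ≤ r') (G : SimpleGraph (Fin n)) :
    omegaTM r G ≤ omegaTM r' G :=
  le_omegaTM_iff.2 ((le_omegaTM_iff.1 le_rfl).map (·.weaken h))

theorem omegaTM_zero {n : ℕ} (G : SimpleGraph (Fin n)) : omegaTM 0 G = omegaNum G := by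
  refine eq_of_forall_le_iff fun k => ?_
  rw [le_omegaTM_iff, le_omegaNum_iff]
  constructor
  · rintro ⟨T⟩
    have key : ∀ i j, i < j → G.Adj (T.branch i) (T.branch j) := fun i j h => by
      have h1 := T.adj i j h 0 (Nat.zero_le _)
      have h2 := T.path_last i j h
      rw [Nat.le_zero.1 (T.len_le i j h)] at h2
      rwa [T.path_zero i j h, h2] at h1
    refine ⟨⟨T.branch, fun {i j} hij => ?_⟩, T.branch_injective⟩
    rcases lt_or_gt_of_ne ((SimpleGraph.top_adj _ _).1 hij) with h | h
    · exact key i j h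
    · exact (key j i h).symm
  · rintro ⟨f, hf⟩
    refine ⟨{
      branch := f
      len := fun _ _ => 0
      path := fun i j n => if n = 0 then f i else f j
      len_le := fun _ _ _ => le_rfl
      path_zero := fun _ _ _ => rfl
      path_last := fun _ _ _ => rfl
      adj := fun i j h n hn => ?_
      branch_injective := hf
      path_ne_branch := fun _ _ _ _ _ _ => by omega
      path_injective := fun _ _ _ _ _ _ _ _ _ _ => by omega }⟩
    obtain rfl := Nat.le_zero.1 hn
    exact f.map_adj h.ne

/-- Ramsey's theorem for pairs, for an arbitrary relation on increasing pairs. -/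
theorem exists_ramsey (k l : ℕ) : ∃ N : ℕ, ∀ {α : Type} [LinearOrder α] (R : α → α → Prop)
    (S : Finset α), N ≤ S.card →
      (∃ K ⊆ S, K.card = k ∧ ∀ i ∈ K, ∀ j ∈ K, i < j → R i j) ∨
      (∃ K ⊆ S, K.card = l ∧ ∀ i ∈ K, ∀ j ∈ K, i < j → ¬ R i j) := by
  classical
  induction k generalizing l with
  | zero => exact ⟨0, fun R S _ => Or.inl ⟨∅, by simp⟩⟩
  | succ k ihk =>
    induction l with
    | zero => exact ⟨0, fun R S _ => Or.inr ⟨∅, by simp⟩⟩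
    | succ l ihl =>
      obtain ⟨N₁, h₁⟩ := ihk (l + 1)
      obtain ⟨N₂, h₂⟩ := ihl
      refine ⟨N₁ + N₂ + 1, fun {α} _ R S hS => ?_⟩
      have hne : S.Nonempty := Finset.card_pos.1 (by omega)
      set x := S.min' hne with hx
      have hlt : ∀ y ∈ S.erase x, x < y := fun y hy =>
        lt_of_le_of_ne (S.min'_le y (Finset.mem_of_mem_erase hy)) (Finset.ne_of_mem_erase hy).symm
      have hsplit := Finset.card_filter_add_card_filter_not (s := S.erase x) (fun y => R x y)
      rw [Finset.card_erase_of_mem (S.min'_mem hne)] at hsplit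
      have hsub : ∀ (Q : α → Prop) [DecidablePred Q], (S.erase x).filter Q ⊆ S := fun Q _ =>
        (Finset.filter_subset _ _).trans (Finset.erase_subset _ _)
      have extend : ∀ (Q : α → α → Prop) (K : Finset α), (∀ y ∈ K, y ∈ S.erase x ∧ Q x y) →
          (∀ i ∈ K, ∀ j ∈ K, i < j → Q i j) →
          insert x K ⊆ S ∧ (insert x K).card = K.card + 1 ∧
            ∀ i ∈ insert x K, ∀ j ∈ insert x K, i < j → Q i j := by
        intro Q K hK hQ
        refine ⟨Finset.insert_subset (S.min'_mem hne) fun y hy => Finset.mem_of_mem_erase (hK y hy).1,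
          Finset.card_insert_of_notMem fun h => ?_, ?_⟩
        · simpa using (hK _ h).1
        · intro i hi j hj hij
          rcases Finset.mem_insert.1 hi with rfl | hi
          · rcases Finset.mem_insert.1 hj with rfl | hj
            · exact (lt_irrefl _ hij).elim
            · exact (hK j hj).2
          · rcases Finset.mem_insert.1 hj with rfl | hj
            · exact (lt_asymm hij (hlt i (hK i hi).1)).elim
            · exact hQ i hi j hj hij
      by_cases hc : N₁ ≤ ((S.erase x).filter (fun y => R x y)).card
      · rcases h₁ R _ hc with ⟨K, hK, hcard, hR⟩ | ⟨K, hK, hcard, hR⟩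
        · obtain ⟨ha, hb, hd⟩ := extend R K (fun y hy => Finset.mem_filter.1 (hK hy)) hR
          exact Or.inl ⟨_, ha, by omega, hd⟩
        · exact Or.inr ⟨K, hK.trans (hsub _), hcard, hR⟩
      · rcases h₂ R ((S.erase x).filter (fun y => ¬ R x y)) (by omega) with
          ⟨K, hK, hcard, hR⟩ | ⟨K, hK, hcard, hR⟩
        · exact Or.inl ⟨K, hK.trans (hsub _), hcard, hR⟩
        · obtain ⟨ha, hb, hd⟩ := extend (fun i j => ¬ R i j) K
            (fun y hy => Finset.mem_filter.1 (hK hy)) hR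
          exact Or.inr ⟨_, ha, by omega, hd⟩

theorem card_filter_superset_le {N m : ℕ} {B : Finset (Fin N)} (hB : 3 ≤ B.card) :
    ((Finset.powersetCard (m + 3) (Finset.univ : Finset (Fin N))).filter (B ⊆ ·)).card ≤
      (N - 3).choose m := by
  obtain ⟨B', hB', hc⟩ := Finset.exists_subset_card_eq hB
  calc _ ≤ (Finset.powersetCard m (Finset.univ \ B')).card := by
        refine Finset.card_le_card_of_injOn (· \ B') ?_ ?_
        · intro S hS
          have hS := Finset.mem_filter.1 (Finset.mem_coe.1 hS)
          refine Finset.mem_coe.2 (Finset.mem_powersetCard.2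
            ⟨Finset.sdiff_subset_sdiff (Finset.subset_univ _) le_rfl, ?_⟩)
          rw [Finset.card_sdiff_of_subset (hB'.trans hS.2), (Finset.mem_powersetCard.1 hS.1).2, hc]
          omega
        · intro S hS S' hS' h
          have hS := Finset.mem_filter.1 (Finset.mem_coe.1 hS)
          have hS' := Finset.mem_filter.1 (Finset.mem_coe.1 hS')
          rw [← Finset.sdiff_union_of_subset (hB'.trans hS.2),
            ← Finset.sdiff_union_of_subset (hB'.trans hS'.2)]
          exact congrArg (· ∪ B') h
    _ = _ := by
        rw [Finset.card_powersetCard, Finset.card_sdiff_of_subset (Finset.subset_univ _), hc,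
          Finset.card_univ, Fintype.card_fin]

/-- A family of `O(N²)` sets with at least three elements each leaves large independent sets. -/
theorem exists_independent_of_card_le (D m : ℕ) : ∃ N₀ : ℕ, ∀ N, N₀ ≤ N →
    ∀ 𝓑 : Finset (Finset (Fin N)), (∀ B ∈ 𝓑, 3 ≤ B.card) → 𝓑.card ≤ D * N ^ 2 →
      ∃ S : Finset (Fin N), S.card = m ∧ ∀ B ∈ 𝓑, ¬ B ⊆ S := by
  refine ⟨4 * D * (m + 3) ^ 3 + m + 4, fun N hN 𝓑 h3 hcard => ?_⟩
  suffices h : ∃ S ∈ Finset.powersetCard (m + 3) (Finset.univ : Finset (Fin N)),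
      ∀ B ∈ 𝓑, ¬ B ⊆ S by
    obtain ⟨S, hS, hB⟩ := h
    obtain ⟨S', hS', hc⟩ := Finset.exists_subset_card_eq
      (show m ≤ S.card by rw [(Finset.mem_powersetCard.1 hS).2]; omega)
    exact ⟨S', hc, fun B h1 h2 => hB B h1 (h2.trans hS')⟩
  by_contra! hcon
  have hle : N.choose (m + 3) ≤ D * N ^ 2 * (N - 3).choose m := by
    calc N.choose (m + 3)
        = (Finset.powersetCard (m + 3) (Finset.univ : Finset (Fin N))).card := by simp
      _ ≤ (𝓑.biUnion fun B => (Finset.powersetCard (m + 3)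
            (Finset.univ : Finset (Fin N))).filter (B ⊆ ·)).card := by
          refine Finset.card_le_card fun S hS => ?_
          obtain ⟨B, hB, hBS⟩ := hcon S hS
          exact Finset.mem_biUnion.2 ⟨B, hB, Finset.mem_filter.2 ⟨hS, hBS⟩⟩
      _ ≤ 𝓑.card * (N - 3).choose m :=
          Finset.card_biUnion_le_card_mul _ _ _ fun B hB => card_filter_superset_le (h3 B hB)
      _ ≤ _ := Nat.mul_le_mul_right _ hcard
  obtain ⟨M, rfl⟩ : ∃ M, N = M + 3 := ⟨N - 3, by omega⟩
  rw [Nat.add_sub_cancel] at hle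
  have hpos : 0 < M.choose m := Nat.choose_pos (by omega)
  have e1 := Nat.add_one_mul_choose_eq (M + 2) (m + 2)
  have e2 := Nat.add_one_mul_choose_eq (M + 1) (m + 1)
  have e3 := Nat.add_one_mul_choose_eq M m
  have heq : (M + 3) * (M + 2) * (M + 1) * M.choose m =
      (M + 3).choose (m + 3) * ((m + 3) * (m + 2) * (m + 1)) := by
    calc _ = (M + 3) * ((M + 2) * ((M + 1) * M.choose m)) := by ring
      _ = (M + 3) * ((M + 1 + 1) * (M + 1).choose (m + 1)) * (m + 1) := by rw [e3]; ring
      _ = (M + 2 + 1) * (M + 2).choose (m + 2) * ((m + 2) * (m + 1)) := by rw [e2]; ring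
      _ = _ := by rw [e1]; ring
  have h4 : (M + 3) * (M + 2) * (M + 1) * M.choose m ≤
      D * (M + 3) ^ 2 * (m + 3) ^ 3 * M.choose m := by
    rw [heq]
    calc _ ≤ D * (M + 3) ^ 2 * M.choose m * ((m + 3) * (m + 3) * (m + 3)) := by gcongr <;> omega
      _ = _ := by ring
  have h5 := Nat.le_of_mul_le_mul_right h4 hpos
  have h6 : (M + 3) * (4 * D * (m + 3) ^ 3 + 1) ≤ 4 * ((M + 2) * (M + 1)) := by
    calc _ ≤ (M + 3) * (M + 3) := Nat.mul_le_mul_left _ (by omega)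
      _ ≤ _ := by
        have : 1 ≤ M := by omega
        nlinarith
  nlinarith [Nat.mul_le_mul_left (M + 3) h6]

/-! ### Tree-depth -/

/-- A forest order of the vertices in `W` witnessing `TreeDepthLE`, seen as a relation on the whole
vertex set. -/
theorem TreeDepthLE.exists_rel {V : Type*} {G : SimpleGraph V} {W : Set V} {h : ℕ}
    (hG : TreeDepthLE (G.induce W) h) : ∃ r : V → V → Prop,
      (∀ v ∈ W, r v v) ∧ (∀ u v w, r u v → r v w → r u w) ∧
      (∀ u v w, r u w → r v w → r u v ∨ r v u) ∧
      (∀ u ∈ W, ∀ v ∈ W, G.Adj u v → r u v ∨ r v u) ∧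
      (∀ v ∈ W, {u | r u v}.ncard ≤ h) := by
  obtain ⟨r, ⟨hrefl, -, htrans, hcomp⟩, hadj, hcard⟩ := hG
  refine ⟨fun u v => ∃ (hu : u ∈ W) (hv : v ∈ W), r ⟨u, hu⟩ ⟨v, hv⟩,
    fun v hv => ⟨hv, hv, hrefl _⟩, ?_, ?_, ?_, ?_⟩
  · rintro u v w ⟨hu, hv, h1⟩ ⟨_, hw, h2⟩
    exact ⟨hu, hw, htrans _ _ _ h1 h2⟩
  · rintro u v w ⟨hu, hw, h1⟩ ⟨hv, _, h2⟩
    exact (hcomp _ _ _ h1 h2).imp (fun h => ⟨hu, hv, h⟩) (fun h => ⟨hv, hu, h⟩)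
  · intro u hu v hv h
    exact (hadj ⟨u, hu⟩ ⟨v, hv⟩ h).imp (fun h => ⟨hu, hv, h⟩) (fun h => ⟨hv, hu, h⟩)
  · intro v hv
    refine le_trans (le_of_eq ?_) (hcard ⟨v, hv⟩)
    rw [← Set.ncard_image_of_injective _ Subtype.val_injective]
    congr 1
    ext u
    constructor
    · rintro ⟨hu, _, huv⟩
      exact ⟨⟨u, hu⟩, huv, rfl⟩
    · rintro ⟨u, huv, rfl⟩
      exact ⟨u.2, hv, huv⟩

/-- A sequence of consecutively comparable elements of a forest has a least element. -/
theorem exists_forall_rel_of_consecutive {V : Type*} {r : V → V → Prop}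
    (htrans : ∀ u v w, r u v → r v w → r u w) (hcomp : ∀ u v w, r u w → r v w → r u v ∨ r v u)
    (y : ℕ → V) (L : ℕ) (hrefl : ∀ n ≤ L, r (y n) (y n))
    (h : ∀ n < L, r (y n) (y (n + 1)) ∨ r (y (n + 1)) (y n)) :
    ∃ q ≤ L, ∀ n ≤ L, r (y q) (y n) := by
  induction L with
  | zero => exact ⟨0, le_rfl, fun n hn => Nat.le_zero.1 hn ▸ hrefl 0 le_rfl⟩
  | succ L ih =>
    obtain ⟨q, hq, hmin⟩ := ih (fun n hn => hrefl n (by omega)) (fun n hn => h n (by omega))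
    have old : r (y q) (y (L + 1)) → ∃ q ≤ L + 1, ∀ n ≤ L + 1, r (y q) (y n) := fun hr =>
      ⟨q, by omega, fun n hn => (Nat.le_succ_iff.1 hn).elim (hmin n) fun e => e ▸ hr⟩
    rcases h L (by omega) with h1 | h1
    · exact old (htrans _ _ _ (hmin L le_rfl) h1)
    · rcases hcomp _ _ _ (hmin L le_rfl) h1 with h2 | h2
      · exact old h2
      · exact ⟨L + 1, le_rfl, fun n hn => (Nat.le_succ_iff.1 hn).elim
          (fun hn => htrans _ _ _ h2 (hmin n hn)) fun e => e ▸ hrefl _ le_rfl⟩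

/-- The infimum defining `χ_p` is attained. -/
theorem exists_coloring_chiP {n : ℕ} (G : SimpleGraph (Fin n)) (p : ℕ) :
    ∃ c : Fin n → Fin (chiP G p), ∀ I : Finset (Fin (chiP G p)), I.card ≤ p →
      TreeDepthLE (G.induce {v | c v ∈ I}) I.card := by
  refine Nat.sInf_mem (s := {N | ∃ c : Fin n → Fin N, ∀ I : Finset (Fin N), I.card ≤ p →
    TreeDepthLE (G.induce {v | c v ∈ I}) I.card}) ⟨n, id, fun I _ => ?_⟩
  refine ⟨(· ≤ ·), ⟨le_refl, fun _ _ => le_antisymm, fun _ _ _ => le_trans,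
    fun u v _ _ _ => le_total u v⟩, fun u v _ => le_total u v, fun v => ?_⟩
  rw [← Set.ncard_image_of_injective _ Subtype.val_injective, ← Set.ncard_coe_finset]
  refine Set.ncard_le_ncard ?_ I.finite_toSet
  rintro _ ⟨u, -, rfl⟩
  exact u.2

/-- A bound on `χ_2` yields an orientation with few in-neighbours of each vertex, which are
distinguished by their colors. -/
theorem exists_orientation_of_chiP_two {n : ℕ} (G : SimpleGraph (Fin n)) :
    ∃ (c : Fin n → Fin (chiP G 2)) (P : Fin n → Fin n → Prop),
      (∀ u v, G.Adj u v → P u v ∨ P v u) ∧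
      ∀ u u' v, P u v → P u' v → c u = c u' → u = u' := by
  obtain ⟨c, hc⟩ := exists_coloring_chiP G 2
  have hI : ∀ I : Finset (Fin (chiP G 2)), ∃ r : Fin n → Fin n → Prop, I.card ≤ 2 →
      (∀ v, c v ∈ I → r v v) ∧ (∀ u v, c u ∈ I → c v ∈ I → G.Adj u v → r u v ∨ r v u) ∧
      (∀ v, c v ∈ I → {u | r u v}.ncard ≤ 2) := by
    intro I
    by_cases h : I.card ≤ 2
    · obtain ⟨r, h1, -, -, h2, h3⟩ := (hc I h).exists_rel
      exact ⟨r, fun _ => ⟨h1, fun u v hu hv => h2 u hu v hv, fun v hv => (h3 v hv).trans h⟩⟩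
    · exact ⟨fun _ _ => True, fun h' => (h h').elim⟩
  choose r hr using hI
  refine ⟨c, fun u v => u ≠ v ∧ r {c u, c v} u v, ?_, ?_⟩
  · intro u v h
    rcases (hr {c u, c v} Finset.card_le_two).2.1 u v (by simp) (by simp) h with h1 | h1
    · exact Or.inl ⟨h.ne, h1⟩
    · exact Or.inr ⟨h.ne.symm, Finset.pair_comm (c u) (c v) ▸ h1⟩
  · rintro u u' v ⟨hu, h1⟩ ⟨hu', h2⟩ heq
    rw [← heq] at h2
    by_contra hne
    have hcard := (hr {c u, c v} Finset.card_le_two).2.2 v (by simp)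
    have hv := (hr {c u, c v} Finset.card_le_two).1 v (by simp)
    have hsub : ((({u, u', v} : Finset (Fin n))) : Set (Fin n)) ⊆ {w | r {c u, c v} w v} := by
      intro w hw
      simp only [Finset.coe_insert, Finset.coe_singleton, Set.mem_insert_iff,
        Set.mem_singleton_iff] at hw
      rcases hw with rfl | rfl | rfl
      · exact h1
      · exact h2
      · exact hv
    have := Set.ncard_le_ncard hsub (Set.toFinite _)
    rw [Set.ncard_coe_finset, Finset.card_eq_three.2 ⟨u, u', v, hne, hu, hu', rfl⟩] at this
    omega

/-! ### Subdivisions of balanced bicliques -/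

/-- The vertices of the `s`-subdivision of `K_{m,m}`. -/
inductive BicliqueVertex (m s : ℕ) : Type
  | left (i : Fin m) : BicliqueVertex m s
  | right (j : Fin m) : BicliqueVertex m s
  | mid (i j : Fin m) (t : Fin s) : BicliqueVertex m s

namespace BicliqueVertex

variable {m s : ℕ}

/-- Base relation of the `s`-subdivision of `K_{m,m}`. -/
def rel : BicliqueVertex m s → BicliqueVertex m s → Prop
  | left i, mid i' _ t => i = i' ∧ (t : ℕ) = 0
  | right j, mid _ j' t => j = j' ∧ (t : ℕ) + 1 = s
  | mid i j t, mid i' j' t' => i = i' ∧ j = j' ∧ (t : ℕ) + 1 = t'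
  | _, _ => False

/-- The `n`-th vertex of the path from `left i` to `right j`. -/
def pos (i j : Fin m) (n : ℕ) : BicliqueVertex m s :=
  if n = 0 then left i else if h : n - 1 < s then mid i j ⟨n - 1, h⟩ else right j

@[simp] theorem pos_zero (i j : Fin m) : (pos i j 0 : BicliqueVertex m s) = left i := by simp [pos]

@[simp] theorem pos_last (i j : Fin m) : (pos i j (s + 1) : BicliqueVertex m s) = right j := by
  simp [pos]

theorem pos_succ (i j : Fin m) {n : ℕ} (h : n < s) : pos i j (n + 1) = mid i j ⟨n, h⟩ := by
  simp [pos, h]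

theorem pos_right_injective {i j j' : Fin m} {n n' : ℕ} (hn : n ≠ 0) (hn' : n' ≠ 0)
    (h : (pos i j n : BicliqueVertex m s) = pos i j' n') : j = j' := by
  simp only [pos, hn, hn', if_false] at h
  split_ifs at h <;> simp_all

end BicliqueVertex

open BicliqueVertex in
/-- The `s`-subdivision of `K_{m,m}`. -/
def bicliqueSubdiv (m s : ℕ) : SimpleGraph (BicliqueVertex m s) :=
  SimpleGraph.fromRel rel

namespace bicliqueSubdiv

open BicliqueVertex

variable {m s : ℕ}

theorem adj_of_rel {u v : BicliqueVertex m s} (h : rel u v) : (bicliqueSubdiv m s).Adj u v := by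
  refine (SimpleGraph.fromRel_adj _ _ _).2 ⟨?_, Or.inl h⟩
  rintro rfl
  cases u <;> simp [rel] at h

theorem adj_iff {u v : BicliqueVertex m s} :
    (bicliqueSubdiv m s).Adj u v ↔ rel u v ∨ rel v u :=
  ⟨fun h => ((SimpleGraph.fromRel_adj _ _ _).1 h).2,
    fun h => h.elim adj_of_rel fun h => (adj_of_rel h).symm⟩

theorem adj_pos (hs : 1 ≤ s) (i j : Fin m) {n : ℕ} (hn : n ≤ s) :
    (bicliqueSubdiv m s).Adj (pos i j n) (pos i j (n + 1)) := by
  rcases n with _ | n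
  · rw [pos_zero, pos_succ i j hs]
    exact adj_of_rel ⟨rfl, rfl⟩
  · rw [pos_succ i j hn]
    rcases hn.eq_or_lt with h | h
    · rw [h, pos_last]
      exact (adj_of_rel (u := right j) (v := mid i j _) ⟨rfl, h⟩).symm
    · rw [pos_succ i j h]
      exact adj_of_rel ⟨rfl, rfl, rfl⟩

theorem eq_pos_of_adj_mid {i j : Fin m} {t : Fin s} {v : BicliqueVertex m s}
    (h : (bicliqueSubdiv m s).Adj (mid i j t) v) : v = pos i j t ∨ v = pos i j (t + 2) := by
  obtain ⟨t, ht⟩ := t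
  rcases adj_iff.1 h with h | h <;> rcases v with i' | j' | ⟨i', j', t', ht'⟩ <;>
    simp only [rel] at h
  · obtain ⟨rfl, rfl, rfl⟩ := h
    exact Or.inr (pos_succ i j ht').symm
  · obtain ⟨rfl, rfl⟩ := h
    exact Or.inl (pos_zero _ _).symm
  · obtain ⟨rfl, rfl⟩ := h
    exact Or.inr (pos_last _ _).symm
  · obtain ⟨rfl, rfl, rfl⟩ := h
    exact Or.inl (pos_succ _ _ _).symm

/-- A graph containing the `s`-subdivision of `K_{m,m}` with `m` large has large `χ_{s+2}`. -/
theorem le_of_chiP {n : ℕ} {G : SimpleGraph (Fin n)} (hs : 1 ≤ s)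
    (f : bicliqueSubdiv m s →g G) (hf : Function.Injective f) :
    m ≤ 2 * (s + 2) * 2 ^ chiP G (s + 2) := by
  classical
  obtain ⟨c, hc⟩ := exists_coloring_chiP G (s + 2)
  let y : Fin m → Fin m → ℕ → Fin n := fun i j q => f (pos i j q)
  let I : Fin m × Fin m → Finset (Fin (chiP G (s + 2))) :=
    fun x => (Finset.range (s + 2)).image fun q => c (y x.1 x.2 q)
  have hI : ∀ x, (I x).card ≤ s + 2 := fun x =>
    Finset.card_image_le.trans (Finset.card_range _).le
  have hmem : ∀ x q, q ≤ s + 1 → c (y x.1 x.2 q) ∈ I x := fun x q hq =>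
    Finset.mem_image.2 ⟨q, Finset.mem_range.2 (by omega), rfl⟩
  have fiber : ∀ J ∈ (Finset.univ : Finset (Fin m × Fin m)).image I,
      (Finset.univ.filter fun x => I x = J).card ≤ 2 * (s + 2) * m := by
    intro J hJ
    obtain ⟨x₀, -, rfl⟩ := Finset.mem_image.1 hJ
    generalize hJ' : I x₀ = J
    have hJc : J.card ≤ s + 2 := hJ' ▸ hI x₀
    obtain ⟨r, hrefl, htrans, hcomp, hadj, hcard⟩ := (hc J hJc).exists_rel
    have hq : ∀ x, ∃ q, I x = J → q ≤ s + 1 ∧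
        ∀ k ≤ s + 1, r (y x.1 x.2 q) (y x.1 x.2 k) := by
      intro x
      by_cases hx : I x = J
      · have hm : ∀ k ≤ s + 1, c (y x.1 x.2 k) ∈ J := fun k hk => hx ▸ hmem x k hk
        obtain ⟨q, h1, h2⟩ := exists_forall_rel_of_consecutive htrans hcomp (y x.1 x.2) (s + 1)
          (fun k hk => hrefl _ (hm k hk)) (fun k hk => hadj _ (hm k hk.le) _ (hm (k + 1) hk)
            (f.map_adj (adj_pos hs _ _ (by omega))))
        exact ⟨q, fun _ => ⟨h1, h2⟩⟩
      · exact ⟨0, fun h => (hx h).elim⟩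
    choose q hq using hq
    have count : ∀ (E : Finset (Fin m × Fin m)) (g : Fin m × Fin m → Fin m)
        (w : Fin m → Fin n), (∀ x ∈ E, c (w (g x)) ∈ J ∧ r (y x.1 x.2 (q x)) (w (g x))) →
        (∀ x ∈ E, ∀ x' ∈ E, g x = g x' → y x.1 x.2 (q x) = y x'.1 x'.2 (q x') → x = x') →
        E.card ≤ (s + 2) * m := by
      intro E g w hE hinj
      refine (Finset.card_le_mul_card_image (f := g) E (s + 2) fun a ha => ?_).trans
        (Nat.mul_le_mul_left _ ((Finset.card_le_univ _).trans (Fintype.card_fin m).le))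
      obtain ⟨x₁, hx₁, rfl⟩ := Finset.mem_image.1 ha
      refine le_trans ?_ ((hcard _ (hE x₁ hx₁).1).trans hJc)
      rw [Set.ncard_eq_toFinset_card _ (Set.toFinite _)]
      refine Finset.card_le_card_of_injOn (fun x => y x.1 x.2 (q x)) ?_ ?_
      · intro x hx
        have hx := Finset.mem_filter.1 (Finset.mem_coe.1 hx)
        simpa [← hx.2] using (hE x hx.1).2
      · intro x hx x' hx' h
        have hx := Finset.mem_filter.1 (Finset.mem_coe.1 hx)
        have hx' := Finset.mem_filter.1 (Finset.mem_coe.1 hx')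
        exact hinj x hx.1 x' hx'.1 (hx.2.trans hx'.2.symm) h
    rw [← Finset.card_filter_add_card_filter_not (s := Finset.univ.filter fun x => I x = J)
      (fun x => q x = 0), mul_assoc, two_mul]
    simp only [Finset.filter_filter]
    refine Nat.add_le_add (count _ Prod.snd (fun j => f (right j)) ?_ ?_)
      (count _ Prod.fst (fun i => f (left i)) ?_ ?_)
    · intro x hx
      simp only [Finset.mem_filter, Finset.mem_univ, true_and] at hx
      have h1 := hmem x (s + 1) le_rfl
      have h2 := (hq x hx.1).2 (s + 1) le_rfl
      simp only [y, pos_last] at h1 h2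
      exact ⟨hx.1 ▸ h1, h2⟩
    · intro x hx x' hx' hsnd h
      simp only [Finset.mem_filter, Finset.mem_univ, true_and] at hx hx'
      simp only [hx.2, hx'.2, y, pos_zero] at h
      exact Prod.ext (by simpa using hf h) hsnd
    · intro x hx
      simp only [Finset.mem_filter, Finset.mem_univ, true_and] at hx
      have h1 := hmem x 0 (Nat.zero_le _)
      have h2 := (hq x hx.1).2 0 (Nat.zero_le _)
      simp only [y, pos_zero] at h1 h2
      exact ⟨hx.1 ▸ h1, h2⟩
    · intro x hx x' hx' hfst h
      simp only [Finset.mem_filter, Finset.mem_univ, true_and] at hx hx'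
      have h := hf h
      rw [hfst] at h
      exact Prod.ext hfst (pos_right_injective hx.2 hx'.2 h)
  have htot := Finset.card_le_mul_card_image (f := I) Finset.univ _ fiber
  have himg : (Finset.univ.image I).card ≤ 2 ^ chiP G (s + 2) :=
    (Finset.card_le_univ _).trans (by simp)
  rw [Finset.card_univ, Fintype.card_prod, Fintype.card_fin] at htot
  rcases Nat.eq_zero_or_pos m with h0 | h0
  · omega
  · refine Nat.le_of_mul_le_mul_right ?_ h0
    calc m * m ≤ _ := htot
      _ ≤ 2 * (s + 2) * m * 2 ^ chiP G (s + 2) := Nat.mul_le_mul_left _ himg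
      _ = _ := by ring

end bicliqueSubdiv

namespace TopClique

variable {V : Type*} {r k : ℕ} {G : SimpleGraph V}

theorem path_one_injective (T : TopClique r G k) {i j j' : Fin k} (h : i < j) (h' : i < j')
    (heq : T.path i j 1 = T.path i j' 1) : j = j' := by
  have hl := T.path_last i j h
  have hl' := T.path_last i j' h'
  rcases Nat.eq_zero_or_pos (T.len i j) with h0 | h0 <;>
    rcases Nat.eq_zero_or_pos (T.len i j') with h0' | h0'
  · rw [h0] at hl
    rw [h0'] at hl'
    exact T.branch_injective (hl.symm.trans (heq.trans hl'))
  · rw [h0] at hl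
    exact (T.path_ne_branch i j' h' 1 le_rfl h0' j (heq.symm.trans hl)).elim
  · rw [h0'] at hl'
    exact (T.path_ne_branch i j h 1 le_rfl h0 j' (heq.trans hl')).elim
  · exact (T.path_injective i j h i j' h' 1 le_rfl h0 1 le_rfl h0' heq).2.1

/-- A function that grows by at most `1` along edges grows by at most `r + 1` between branch
vertices. -/
theorem potential_le (T : TopClique r G k) (φ : V → ℕ) (hφ : ∀ u v, G.Adj u v → φ v ≤ φ u + 1)
    {i j : Fin k} (h : i < j) : φ (T.branch j) ≤ φ (T.branch i) + (r + 1) := by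
  have key : ∀ n ≤ T.len i j + 1, φ (T.path i j n) ≤ φ (T.branch i) + n := by
    intro n
    induction n with
    | zero => intro _; rw [T.path_zero i j h]; exact le_rfl
    | succ n ih =>
      intro hn
      have := hφ _ _ (T.adj i j h n (by omega))
      have := ih (by omega)
      omega
  have := key _ le_rfl
  rw [T.path_last i j h] at this
  have := T.len_le i j h
  omega

end TopClique

namespace bicliqueSubdiv

open BicliqueVertex

variable {m s : ℕ}

/-- A potential that separates distinct branch vertices on the left side. -/
def leftPotential (i₀ : Fin m) : BicliqueVertex m s → ℕ
  | left i => if i = i₀ then 0 else 2 * (s + 1)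
  | right _ => s + 1
  | mid i _ t => if i = i₀ then t + 1 else 2 * (s + 1) - (t + 1)

/-- A potential that separates distinct branch vertices on the right side. -/
def rightPotential (j₀ : Fin m) : BicliqueVertex m s → ℕ
  | left _ => s + 1
  | right j => if j = j₀ then 0 else 2 * (s + 1)
  | mid _ j t => if j = j₀ then s - t else s + 2 + t

theorem leftPotential_le (i₀ : Fin m) (u v : BicliqueVertex m s)
    (h : (bicliqueSubdiv m s).Adj u v) : leftPotential i₀ v ≤ leftPotential i₀ u + 1 := by
  rcases adj_iff.1 h with h | h <;> rcases u with i | j | ⟨i, j, t, ht⟩ <;>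
    rcases v with i' | j' | ⟨i', j', t', ht'⟩ <;> simp only [rel] at h <;>
    simp only [leftPotential] <;> split_ifs <;> omega

theorem rightPotential_le (j₀ : Fin m) (u v : BicliqueVertex m s)
    (h : (bicliqueSubdiv m s).Adj u v) : rightPotential j₀ v ≤ rightPotential j₀ u + 1 := by
  rcases adj_iff.1 h with h | h <;> rcases u with i | j | ⟨i, j, t, ht⟩ <;>
    rcases v with i' | j' | ⟨i', j', t', ht'⟩ <;> simp only [rel] at h <;>
    simp only [rightPotential] <;> split_ifs <;> omega

theorem branch_ne_mid {r : ℕ} (T : TopClique r (bicliqueSubdiv m s) 6) (l : Fin 6) (hl : l < 3)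
    (i j : Fin m) (t : Fin s) : T.branch l ≠ mid i j t := by
  intro h
  have key : ∀ l', l < l' →
      T.path l l' 1 = pos i j t ∨ T.path l l' 1 = pos i j (t + 2) := fun l' hl' => by
    have := T.adj l l' hl' 0 (Nat.zero_le _)
    rw [T.path_zero l l' hl', h] at this
    exact eq_pos_of_adj_mid this
  have ne : ∀ l₁ l₂, l < l₁ → l < l₂ → l₁ ≠ l₂ → T.path l l₁ 1 ≠ T.path l l₂ 1 :=
    fun l₁ l₂ h₁ h₂ hne heq => hne (T.path_one_injective h₁ h₂ heq)
  have h4 : l < 4 := hl.trans (by decide)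
  have h5 : l < 5 := hl.trans (by decide)
  have h34 := ne 3 4 hl h4 (by decide)
  have h35 := ne 3 5 hl h5 (by decide)
  have h45 := ne 4 5 h4 h5 (by decide)
  rcases key 3 hl with h3 | h3 <;> rcases key 4 h4 with h4 | h4 <;>
    rcases key 5 h5 with h5 | h5 <;> simp_all

/-- The `s`-subdivision of `K_{m,m}` contains no `(≤ s + 1)`-subdivision of a large clique. -/
theorem isEmpty_topClique (hs : 1 ≤ s) :
    IsEmpty (TopClique (s + 1) (bicliqueSubdiv m s) 6) := by
  refine ⟨fun T => ?_⟩
  have hleft : ∀ l l' : Fin 6, l < l' → ∀ i i', T.branch l = left i → T.branch l' ≠ left i' := by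
    intro l l' h i i' hi hi'
    have hne : i' ≠ i := fun e => h.ne (T.branch_injective (by rw [hi, hi', e]))
    have := T.potential_le (leftPotential i) (leftPotential_le i) h
    simp only [hi, hi', leftPotential, hne, if_true, if_false] at this
    omega
  have hright : ∀ l l' : Fin 6, l < l' → ∀ j j', T.branch l = right j →
      T.branch l' ≠ right j' := by
    intro l l' h j j' hj hj'
    have hne : j' ≠ j := fun e => h.ne (T.branch_injective (by rw [hj, hj', e]))
    have := T.potential_le (rightPotential j) (rightPotential_le j) h
    simp only [hj, hj', rightPotential, hne, if_true, if_false] at this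
    omega
  rcases h0 : T.branch 0 with i | j | ⟨i, j, t⟩
  · rcases h1 : T.branch 1 with i' | j' | ⟨i', j', t'⟩
    · exact hleft 0 1 (by decide) _ _ h0 h1
    · rcases h2 : T.branch 2 with i'' | j'' | ⟨i'', j'', t''⟩
      · exact hleft 0 2 (by decide) _ _ h0 h2
      · exact hright 1 2 (by decide) _ _ h1 h2
      · exact branch_ne_mid T 2 (by decide) _ _ _ h2
    · exact branch_ne_mid T 1 (by decide) _ _ _ h1
  · rcases h1 : T.branch 1 with i' | j' | ⟨i', j', t'⟩
    · rcases h2 : T.branch 2 with i'' | j'' | ⟨i'', j'', t''⟩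
      · exact hleft 1 2 (by decide) _ _ h1 h2
      · exact hright 0 2 (by decide) _ _ h0 h2
      · exact branch_ne_mid T 2 (by decide) _ _ _ h2
    · exact hright 0 1 (by decide) _ _ h0 h1
    · exact branch_ne_mid T 1 (by decide) _ _ _ h1
  · exact branch_ne_mid T 0 (by decide) _ _ _ h0

end bicliqueSubdiv

namespace TopClique

variable {V : Type*} {r k : ℕ} {G : SimpleGraph V}

/-- Every edge of `K_k` is subdivided exactly `r` times, and the resulting paths are induced. -/
def IsTight (T : TopClique r G k) : Prop :=
  ∀ i j, i < j → T.len i j = r ∧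
    ∀ a b, a < b → b ≤ r + 1 → G.Adj (T.path i j a) (T.path i j b) → b = a + 1

/-- The path from `i` to `j` can be shortcut to one with at most `r` internal vertices. -/
def HasShortcut {r' : ℕ} (T : TopClique r' G k) (r : ℕ) (i j : Fin k) : Prop :=
  ∃ (L : ℕ) (σ : ℕ → ℕ), L ≤ r ∧ σ 0 = 0 ∧ σ (L + 1) = T.len i j + 1 ∧ StrictMono σ ∧
    ∀ n ≤ L, G.Adj (T.path i j (σ n)) (T.path i j (σ (n + 1)))

theorem hasShortcut_of_chord (T : TopClique (r + 1) G k) {i j : Fin k} (hij : i < j) {a b : ℕ}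
    (hab : a + 1 < b) (hb : b ≤ T.len i j + 1) (h : G.Adj (T.path i j a) (T.path i j b)) :
    T.HasShortcut r i j := by
  have hlen := T.len_le i j hij
  refine ⟨T.len i j - (b - a - 1), fun n => if n ≤ a then n else n + (b - a - 1), by omega,
    by simp, ?_, ?_, ?_⟩
  · simp only
    split_ifs <;> omega
  · refine strictMono_nat_of_lt_succ fun n => ?_
    split_ifs <;> omega
  · intro n hn
    rcases lt_trichotomy n a with hna | rfl | hna
    · simpa [hna.le, Nat.succ_le_of_lt hna] using T.adj i j hij n (by omega)
    · have : n + 1 + (b - n - 1) = b := by omega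
      simpa [this] using h
    · have h1 : ¬ n ≤ a := by omega
      have h2 : ¬ n + 1 ≤ a := by omega
      have h3 : n + 1 + (b - a - 1) = n + (b - a - 1) + 1 := by omega
      simpa only [h1, h2, if_false, h3] using T.adj i j hij (n + (b - a - 1)) (by omega)

/-- If `G` contains no `(≤ r)`-subdivision of `K_k`, then a large `(≤ r + 1)`-subdivided clique
contains a tight one. -/
theorem exists_isTight (r k N : ℕ) : ∃ M : ℕ, ∀ {V : Type} {G : SimpleGraph V},
    IsEmpty (TopClique r G k) → TopClique (r + 1) G M →
      ∃ T : TopClique (r + 1) G N, T.IsTight := by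
  obtain ⟨M, hM⟩ := exists_ramsey k N
  refine ⟨M, fun {V G} hempty T => ?_⟩
  rcases hM (fun i j => T.HasShortcut r i j) Finset.univ (by simp) with
    ⟨K, -, hK, hR⟩ | ⟨K, -, hK, hR⟩
  · set e := K.orderEmbOfFin hK
    have h : ∀ i j, ∃ (L : ℕ) (σ : ℕ → ℕ), i < j → L ≤ r ∧ σ 0 = 0 ∧
        σ (L + 1) = T.len (e i) (e j) + 1 ∧ StrictMono σ ∧
        ∀ n ≤ L, G.Adj (T.path (e i) (e j) (σ n)) (T.path (e i) (e j) (σ (n + 1))) := by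
      intro i j
      by_cases hij : i < j
      · obtain ⟨L, σ, h⟩ := hR _ (K.orderEmbOfFin_mem hK i) _ (K.orderEmbOfFin_mem hK j)
          (e.strictMono hij)
        exact ⟨L, σ, fun _ => h⟩
      · exact ⟨0, id, fun h => (hij h).elim⟩
    choose L σ h using h
    exact hempty.elim (T.reroute e L σ (fun i j hij => (h i j hij).1)
      (fun i j hij => (h i j hij).2.1) (fun i j hij => (h i j hij).2.2.1)
      (fun i j hij => (h i j hij).2.2.2.1) (fun i j hij => (h i j hij).2.2.2.2))
  · refine ⟨T.restrict (K.orderEmbOfFin hK), fun i j hij => ?_⟩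
    have hij' := (K.orderEmbOfFin hK).strictMono hij
    have hno := hR _ (K.orderEmbOfFin_mem hK i) _ (K.orderEmbOfFin_mem hK j) hij'
    have hlen : T.len (K.orderEmbOfFin hK i) (K.orderEmbOfFin hK j) = r + 1 := by
      refine le_antisymm (T.len_le _ _ hij') (Nat.lt_of_not_le fun hle => hno ?_)
      exact ⟨_, id, hle, rfl, rfl, strictMono_id, T.adj _ _ hij'⟩
    refine ⟨hlen, fun a b hab hb hadj => ?_⟩
    by_contra hne
    exact hno (T.hasShortcut_of_chord (a := a) (b := b) hij' (by omega) (by omega) hadj)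

/-- The vertices of a tight topological clique: branch vertices, and internal vertices of the
paths. -/
def vertex (T : TopClique r G k) : Fin k ⊕ (Fin k × Fin k × Fin r) → V
  | Sum.inl i => T.branch i
  | Sum.inr (i, j, t) => T.path i j (t + 1)

/-- The indices of the ends of the path on which a vertex lies. -/
def label : Fin k ⊕ (Fin k × Fin k × Fin r) → Finset (Fin k)
  | Sum.inl i => {i}
  | Sum.inr (i, j, _) => {i, j}

/-- The indices of actual vertices. -/
def Valid : Fin k ⊕ (Fin k × Fin k × Fin r) → Prop
  | Sum.inl _ => True
  | Sum.inr (i, j, _) => i < j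

theorem IsTight.vertex_injective {T : TopClique r G k} (hT : T.IsTight)
    {w w' : Fin k ⊕ (Fin k × Fin k × Fin r)} (hw : Valid w) (hw' : Valid w')
    (h : T.vertex w = T.vertex w') : w = w' := by
  rcases w with i | ⟨i, j, t⟩ <;> rcases w' with i' | ⟨i', j', t'⟩
  · exact congrArg _ (T.branch_injective h)
  · exact (T.path_ne_branch i' j' hw' (t' + 1) (by omega) (by rw [(hT _ _ hw').1]; omega) i
      h.symm).elim
  · exact (T.path_ne_branch i j hw (t + 1) (by omega) (by rw [(hT _ _ hw).1]; omega) i' h).elim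
  · obtain ⟨rfl, rfl, h⟩ := T.path_injective i j hw i' j' hw' (t + 1) (by omega)
      (by rw [(hT _ _ hw).1]; omega) (t' + 1) (by omega) (by rw [(hT _ _ hw').1]; omega) h
    obtain rfl : t = t' := Fin.ext (by omega)
    rfl

/-- In a graph with bounded `χ_2`, a large tight topological clique has a large set `S` of branch
vertices such that no edge joins vertices of different paths between elements of `S`. -/
theorem exists_sparse (r c m : ℕ) : ∃ N : ℕ, ∀ {n : ℕ} {G : SimpleGraph (Fin n)},
    chiP G 2 ≤ c → ∀ T : TopClique r G N, T.IsTight →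
      ∃ S : Finset (Fin N), S.card = m ∧ ∀ w w', Valid w → Valid w' → label w ⊆ S →
        label w' ⊆ S → G.Adj (T.vertex w) (T.vertex w') → (label w ∪ label w').card ≤ 2 := by
  classical
  obtain ⟨N, hN⟩ := exists_independent_of_card_le ((r + 1) * c) m
  refine ⟨N, fun {n G} hc T hT => ?_⟩
  obtain ⟨col, P, hP, hinj⟩ := exists_orientation_of_chiP_two G
  let E := (Finset.univ : Finset ((Fin N ⊕ (Fin N × Fin N × Fin r)) ×
    (Fin N ⊕ (Fin N × Fin N × Fin r)))).filter fun x => Valid x.2 ∧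
      P (T.vertex x.2) (T.vertex x.1) ∧ 3 ≤ (label x.1 ∪ label x.2).card
  have hE : E.card ≤ (r + 1) * c * N ^ 2 := by
    calc E.card ≤ (Finset.univ : Finset ((Fin N ⊕ (Fin N × Fin N × Fin r)) ×
          Fin (chiP G 2))).card := by
          refine Finset.card_le_card_of_injOn (fun x => (x.1, col (T.vertex x.2)))
            (fun _ _ => Finset.mem_coe.2 (Finset.mem_univ _)) ?_
          rintro ⟨w, w₁⟩ h₁ ⟨w', w₂⟩ h₂ h
          have h₁ := Finset.mem_filter.1 (Finset.mem_coe.1 h₁)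
          have h₂ := Finset.mem_filter.1 (Finset.mem_coe.1 h₂)
          obtain ⟨rfl, hcol⟩ := Prod.ext_iff.1 h
          exact Prod.ext rfl (hT.vertex_injective h₁.2.1 h₂.2.1
            (hinj _ _ _ h₁.2.2.1 h₂.2.2.1 hcol))
      _ = (N + N * (N * r)) * chiP G 2 := by
          simp
      _ ≤ (N ^ 2 + N * (N * r)) * c := by
          gcongr
          exact Nat.le_self_pow two_ne_zero N
      _ = _ := by ring
  obtain ⟨S, hS, hB⟩ := hN N le_rfl (E.image fun x => label x.1 ∪ label x.2)
    (fun B hB => by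
      obtain ⟨x, hx, rfl⟩ := Finset.mem_image.1 hB
      exact (Finset.mem_filter.1 hx).2.2.2)
    (Finset.card_image_le.trans hE)
  refine ⟨S, hS, fun w w' hw hw' hwS hwS' hadj => ?_⟩
  by_contra hcard
  rcases hP _ _ hadj with h | h
  · exact hB _ (Finset.mem_image.2 ⟨(w', w), Finset.mem_filter.2 ⟨Finset.mem_univ _, hw, h, by
      rw [Finset.union_comm]; exact Nat.lt_of_not_le hcard⟩, rfl⟩) (Finset.union_subset hwS' hwS)
  · exact hB _ (Finset.mem_image.2 ⟨(w, w'), Finset.mem_filter.2 ⟨Finset.mem_univ _, hw', h,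
      Nat.lt_of_not_le hcard⟩, rfl⟩) (Finset.union_subset hwS hwS')

end TopClique

/-- In a graph with bounded `χ_2` and no `(≤ r)`-subdivision of `K_k`, a `(≤ r + 1)`-subdivision of
a large clique forces an induced `(r + 1)`-subdivision of `K_{m,m}`. -/
theorem exists_bicliqueSubdiv_embedding (r k c m : ℕ) : ∃ M : ℕ, ∀ {n : ℕ}
    {G : SimpleGraph (Fin n)}, chiP G 2 ≤ c → IsEmpty (TopClique r G k) →
      TopClique (r + 1) G M → Nonempty (bicliqueSubdiv m (r + 1) ↪g G) := by
  obtain ⟨N, hN⟩ := TopClique.exists_sparse (r + 1) c (m + m)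
  obtain ⟨M, hM⟩ := TopClique.exists_isTight r k N
  refine ⟨M, fun {n G} hc hempty T₀ => ?_⟩
  obtain ⟨T, hT⟩ := hM hempty T₀
  obtain ⟨S, hS, hsparse⟩ := hN hc T hT
  let a : Fin m → Fin N := fun i => S.orderEmbOfFin hS (Fin.castAdd m i)
  let b : Fin m → Fin N := fun j => S.orderEmbOfFin hS (Fin.natAdd m j)
  have ha : Function.Injective a := fun i i' h =>
    Fin.castAdd_injective m m ((S.orderEmbOfFin hS).injective h)
  have hb : Function.Injective b := fun i i' h =>
    Fin.natAdd_injective m m ((S.orderEmbOfFin hS).injective h)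
  have hab : ∀ i j, a i < b j := fun i j =>
    (S.orderEmbOfFin hS).strictMono (Fin.lt_def.2 (by simp; omega))
  have haS : ∀ i, a i ∈ S := fun i => S.orderEmbOfFin_mem hS _
  have hbS : ∀ j, b j ∈ S := fun j => S.orderEmbOfFin_mem hS _
  let ι : BicliqueVertex m (r + 1) → Fin N ⊕ (Fin N × Fin N × Fin (r + 1)) := fun
    | .left i => Sum.inl (a i)
    | .right j => Sum.inl (b j)
    | .mid i j t => Sum.inr (a i, b j, t)
  have hvalid : ∀ u, TopClique.Valid (ι u) := by
    rintro (i | j | ⟨i, j, t⟩)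
    exacts [trivial, trivial, hab i j]
  have hlabel : ∀ u, TopClique.label (ι u) ⊆ S := by
    rintro (i | j | ⟨i, j, t⟩) <;>
      simp [ι, TopClique.label, Finset.insert_subset_iff, haS, hbS]
  have hι : Function.Injective ι := by
    rintro (i | j | ⟨i, j, t⟩) (i' | j' | ⟨i', j', t'⟩) h <;>
      simp only [ι, Sum.inl.injEq, Sum.inr.injEq, Prod.mk.injEq, reduceCtorEq] at h
    · rw [ha h]
    · exact ((hab i j').ne h).elim
    · exact ((hab i' j).ne h.symm).elim
    · rw [hb h]
    · rw [ha h.1, hb h.2.1, h.2.2]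
  let ψ : BicliqueVertex m (r + 1) → Fin n := fun u => T.vertex (ι u)
  have hψ : Function.Injective ψ := fun u v h =>
    hι (hT.vertex_injective (hvalid u) (hvalid v) h)
  have hpos : ∀ i j q, q ≤ r + 2 → ψ (BicliqueVertex.pos i j q) = T.path (a i) (b j) q := by
    intro i j q hq
    rcases q with _ | q
    · rw [BicliqueVertex.pos_zero, T.path_zero _ _ (hab i j)]
      rfl
    · rcases Nat.lt_or_ge q (r + 1) with h | h
      · rw [BicliqueVertex.pos_succ i j h]
        rfl
      · obtain rfl : q = r + 1 := by omega
        have := T.path_last _ _ (hab i j)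
        rw [(hT _ _ (hab i j)).1] at this
        rw [BicliqueVertex.pos_last, this]
        rfl
  have hchord : ∀ p q, p < q → ∀ x y, x ≤ r + 2 → y ≤ r + 2 →
      G.Adj (T.path p q x) (T.path p q y) → y = x + 1 ∨ x = y + 1 := by
    intro p q hpq x y hx hy h
    rcases lt_trichotomy x y with hxy | rfl | hxy
    · exact Or.inl ((hT p q hpq).2 x y hxy hy h)
    · exact (h.ne rfl).elim
    · exact Or.inr ((hT p q hpq).2 y x hxy hx h.symm)
  have hlast : ∀ p q, p < q → T.path p q (r + 2) = T.branch q := fun p q hpq => by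
    simpa only [(hT p q hpq).1] using T.path_last p q hpq
  have hbranch_lt : ∀ p q, p < q → ¬ G.Adj (T.branch p) (T.branch q) := by
    intro p q hpq h
    rw [← T.path_zero p q hpq, ← hlast p q hpq] at h
    rcases hchord p q hpq _ _ (by omega) le_rfl h with h | h <;> omega
  have hbranch : ∀ p q, ¬ G.Adj (T.branch p) (T.branch q) := by
    intro p q h
    rcases lt_trichotomy p q with hpq | rfl | hpq
    · exact hbranch_lt p q hpq h
    · exact h.ne rfl
    · exact hbranch_lt q p hpq h.symm
  have hcard : ∀ u v, G.Adj (ψ u) (ψ v) → ∀ x y z, x ∈ TopClique.label (ι u) ∪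
      TopClique.label (ι v) → y ∈ TopClique.label (ι u) ∪ TopClique.label (ι v) →
      z ∈ TopClique.label (ι u) ∪ TopClique.label (ι v) → x ≠ y → x ≠ z → y ≠ z → False := by
    intro u v h x y z hx hy hz hxy hxz hyz
    exact (hsparse _ _ (hvalid u) (hvalid v) (hlabel u) (hlabel v) h).not_gt
      (Finset.two_lt_card.2 ⟨x, hx, y, hy, z, hz, hxy, hxz, hyz⟩)
  have hleft : ∀ i i' j t, G.Adj (ψ (.left i)) (ψ (.mid i' j t)) →
      BicliqueVertex.rel (.left i) (.mid i' j t : BicliqueVertex m (r + 1)) := by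
    intro i i' j t h
    obtain rfl : i = i' := by
      by_contra hne
      exact hcard (.left i) (.mid i' j t) h (a i) (a i') (b j)
        (by simp [ι, TopClique.label])
        (by simp [ι, TopClique.label]) (by simp [ι, TopClique.label]) (ha.ne hne) (hab i j).ne
        (hab i' j).ne
    have h : G.Adj (T.branch (a i)) (T.path (a i) (b j) (t + 1)) := h
    rw [← T.path_zero _ _ (hab i j)] at h
    rcases hchord _ _ (hab i j) _ _ (by omega) (by omega) h with h | h
    · exact ⟨rfl, by omega⟩
    · omega
  have hright : ∀ j i j' t, G.Adj (ψ (.right j)) (ψ (.mid i j' t)) →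
      BicliqueVertex.rel (.right j) (.mid i j' t : BicliqueVertex m (r + 1)) := by
    intro j i j' t h
    obtain rfl : j = j' := by
      by_contra hne
      exact hcard (.right j) (.mid i j' t) h (a i) (b j) (b j')
        (by simp [ι, TopClique.label])
        (by simp [ι, TopClique.label]) (by simp [ι, TopClique.label]) (hab i j).ne (hab i j').ne
        (hb.ne hne)
    have h : G.Adj (T.branch (b j)) (T.path (a i) (b j) (t + 1)) := h
    rw [← hlast _ _ (hab i j)] at h
    rcases hchord _ _ (hab i j) _ _ le_rfl (by omega) h with h | h
    · omega
    · exact ⟨rfl, by omega⟩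
  have hmid : ∀ i j t i' j' t', G.Adj (ψ (.mid i j t)) (ψ (.mid i' j' t')) →
      BicliqueVertex.rel (.mid i j t) (.mid i' j' t' : BicliqueVertex m (r + 1)) ∨
        BicliqueVertex.rel (.mid i' j' t') (.mid i j t : BicliqueVertex m (r + 1)) := by
    intro i j t i' j' t' h
    obtain rfl : i = i' := by
      by_contra hne
      exact hcard (.mid i j t) (.mid i' j' t') h (a i) (a i') (b j)
        (by simp [ι, TopClique.label])
        (by simp [ι, TopClique.label]) (by simp [ι, TopClique.label]) (ha.ne hne) (hab i j).ne
        (hab i' j).ne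
    obtain rfl : j = j' := by
      by_contra hne
      exact hcard (.mid i j t) (.mid i j' t') h (a i) (b j) (b j')
        (by simp [ι, TopClique.label])
        (by simp [ι, TopClique.label]) (by simp [ι, TopClique.label]) (hab i j).ne (hab i j').ne
        (hb.ne hne)
    have h : G.Adj (T.path (a i) (b j) (t + 1)) (T.path (a i) (b j) (t' + 1)) := h
    rcases hchord _ _ (hab i j) _ _ (by omega) (by omega) h with h | h
    · exact Or.inl ⟨rfl, rfl, by omega⟩
    · exact Or.inr ⟨rfl, rfl, by omega⟩
  have hpath : ∀ i j q, q ≤ r + 1 →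
      G.Adj (ψ (BicliqueVertex.pos i j q)) (ψ (BicliqueVertex.pos i j (q + 1))) := by
    intro i j q hq
    rw [hpos i j q (by omega), hpos i j (q + 1) (by omega)]
    exact T.adj _ _ (hab i j) q (by rwa [(hT _ _ (hab i j)).1])
  have hrel : ∀ u v, BicliqueVertex.rel u v → G.Adj (ψ u) (ψ v) := by
    rintro (i | j | ⟨i, j, t, ht⟩) (i' | j' | ⟨i', j', t', ht'⟩) h <;>
      simp only [BicliqueVertex.rel] at h
    · obtain ⟨rfl, rfl⟩ := h
      have := hpath i j' 0 (by omega)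
      rwa [BicliqueVertex.pos_zero, BicliqueVertex.pos_succ _ _ ht'] at this
    · obtain ⟨rfl, h⟩ := h
      have := hpath i' j (t' + 1) (by omega)
      rw [BicliqueVertex.pos_succ _ _ ht', h, BicliqueVertex.pos_last] at this
      exact this.symm
    · obtain ⟨rfl, rfl, rfl⟩ := h
      have := hpath i j (t + 1) (by omega)
      rwa [BicliqueVertex.pos_succ _ _ ht, BicliqueVertex.pos_succ _ _ ht'] at this
  refine ⟨⟨⟨ψ, hψ⟩, fun {u v} => ?_⟩⟩
  rw [bicliqueSubdiv.adj_iff]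
  refine ⟨fun h => ?_, fun h => h.elim (hrel u v) fun h => (hrel v u h).symm⟩
  change G.Adj (ψ u) (ψ v) at h
  rcases u with i | j | ⟨i, j, t⟩ <;> rcases v with i' | j' | ⟨i', j', t'⟩
  · exact (hbranch _ _ h).elim
  · exact (hbranch _ _ h).elim
  · exact Or.inl (hleft _ _ _ _ h)
  · exact (hbranch _ _ h).elim
  · exact (hbranch _ _ h).elim
  · exact Or.inl (hright _ _ _ _ h)
  · exact Or.inr (hleft _ _ _ _ h.symm)
  · exact Or.inr (hright _ _ _ _ h.symm)
  · exact hmid _ _ _ _ _ _ h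

/-- In a hereditary class whose `χ_p` are weakly bounded, `ω(TM_1)` bounds all `ω(TM_r)`. -/
theorem exists_omegaTM_le {C : GraphClass} (hC : Hereditary C)
    (hw : ∀ p : ℕ, 1 ≤ p → WeaklyChiPBounded C p) (r k : ℕ) :
    ∃ M : ℕ, ∀ ⦃n : ℕ⦄ (G : SimpleGraph (Fin n)), G ∈ C n → omegaTM 1 G ≤ k →
      omegaTM (r + 1) G ≤ M := by
  induction r with
  | zero => exact ⟨k, fun _ _ _ h => h⟩
  | succ r ih =>
    obtain ⟨M₀, hM₀⟩ := ih
    obtain ⟨g₂, hg₂⟩ := hw 2 (by omega)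
    obtain ⟨g, hg⟩ := hw (r + 4) (by omega)
    let c := (Finset.range (k + 1)).sup g₂
    let c' := (Finset.range 6).sup g
    obtain ⟨M, hM⟩ := exists_bicliqueSubdiv_embedding (r + 1) (M₀ + 1) c
      (2 * (r + 4) * 2 ^ c' + 1)
    refine ⟨M, fun n G hG hk => ?_⟩
    by_contra! hlt
    obtain ⟨T⟩ := le_omegaTM_iff.1 hlt.le
    have hchi : chiP G 2 ≤ c :=
      (hg₂ G hG).trans (Finset.le_sup (f := g₂) (Finset.mem_range.2 (Nat.lt_succ_of_le hk)))
    have hempty : IsEmpty (TopClique (r + 1) G (M₀ + 1)) := by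
      rw [← not_nonempty_iff, ← le_omegaTM_iff]
      have := hM₀ G hG hk
      omega
    obtain ⟨f⟩ := hM hchi hempty T
    set m := 2 * (r + 4) * 2 ^ c' + 1 with hm
    have : Finite (BicliqueVertex m (r + 1 + 1)) := Finite.of_injective f f.injective
    let φ := Finite.equivFin (BicliqueVertex m (r + 1 + 1))
    let ψ := SimpleGraph.Iso.map φ (bicliqueSubdiv m (r + 1 + 1))
    have hmem := hC G _ hG ⟨f.comp ψ.symm.toEmbedding⟩
    have homega : omegaTM (r + 4 - 1) ((bicliqueSubdiv m (r + 1 + 1)).map φ.toEmbedding) < 6 := by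
      by_contra! h6
      obtain ⟨T'⟩ := le_omegaTM_iff.1 h6
      exact (bicliqueSubdiv.isEmpty_topClique (s := r + 1 + 1) (by omega)).elim
        (T'.map ψ.symm.toHom ψ.symm.injective)
    have h1 := (hg _ hmem).trans (Finset.le_sup (f := g) (Finset.mem_range.2 homega))
    have h2 := bicliqueSubdiv.le_of_chiP (s := r + 1 + 1) (by omega) ψ.toHom ψ.injective
    have h3 : 2 * (r + 4) * 2 ^ chiP ((bicliqueSubdiv m (r + 1 + 1)).map φ.toEmbedding) (r + 4) ≤
        2 * (r + 4) * 2 ^ c' := Nat.mul_le_mul_left _ (Nat.pow_le_pow_right (by omega) h1)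
    have h4 := h2.trans h3
    omega

/-- a hereditary class is rank-`i` `χ_p`-bounded iff (`i = 0` and it is
strongly `χ_p`-bounded for every positive `p`) or (`i > 0` and it is weakly `χ_p`-bounded
for every positive `p`). -/
theorem rank_i_chiP_bounded_iff (i : ℕ) (C : GraphClass) (hC : Hereditary C) :
    (∀ p : ℕ, 1 ≤ p → ∃ f : ℕ → ℕ, ∀ ⦃n : ℕ⦄ (G : SimpleGraph (Fin n)), G ∈ C n →
        chiP G p ≤ f (omegaTM (min i (p - 1)) G)) ↔
      ((i = 0 ∧ ∀ p : ℕ, 1 ≤ p → StronglyChiPBounded C p) ∨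
       (0 < i ∧ ∀ p : ℕ, 1 ≤ p → WeaklyChiPBounded C p)) := by
  rcases Nat.eq_zero_or_pos i with rfl | hi
  · simp only [Nat.zero_min, omegaTM_zero, lt_irrefl, false_and, or_false, true_and]
    rfl
  · simp only [hi, hi.ne', false_and, true_and, false_or]
    constructor
    · intro h p hp
      obtain ⟨f, hf⟩ := h p hp
      refine ⟨fun k => (Finset.range (k + 1)).sup f, fun n G hG => (hf G hG).trans ?_⟩
      exact Finset.le_sup (f := f) (Finset.mem_range.2
        (Nat.lt_succ_of_le (omegaTM_mono (min_le_right _ _) G)))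
    · intro h p hp
      obtain ⟨g, hg⟩ := h p hp
      rcases le_total (p - 1) i with hpi | hpi
      · exact ⟨g, fun n G hG => by simpa only [min_eq_right hpi] using hg G hG⟩
      · choose M hM using fun k => exists_omegaTM_le hC h (p - 2) k
        refine ⟨fun k => (Finset.range (M k + 1)).sup g, fun n G hG => (hg G hG).trans ?_⟩
        rw [min_eq_left hpi]
        have hle := hM (omegaTM i G) G hG (omegaTM_mono hi G)
        rw [show p - 2 + 1 = p - 1 by omega] at hle
        exact Finset.le_sup (f := g) (Finset.mem_range.2 (Nat.lt_succ_of_le hle))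
end
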